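/- arXiv:1710.01424 — 5 statements merged into one kernel-verified Lean document; each statement's English description precedes it below -/
import Mathlib

section
/- (Zaslavsky's theorem, bounded regions.) Let 𝒜 = (H_i)_{i∈I} be a hyperplane arrangement in ℝ^d that is essential, i.e., r(𝒜) = d. Then the number of bounded connected components of the complement ℝ^d ∖ ⋃_{i∈I} H_i equals (−1)^d Σ_{ℬ ⊆ I central} (−1)^{|ℬ|}, which equals (−1)^d χ(𝒜; 1). -/
open scoped Classical

section SignVectors

variable {V I : Type*} [AddCommGroup V] [Module ℝ V]

/-- The open polyhedron cut out in `W` by the inequalities `β i < m i x` for `i ∈ T` is nonempty,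
and every direction of its recession cone lies in its lineality space. -/
def IsRelBddCell (W : Submodule ℝ V) (T : Finset I) (m : I → V →ₗ[ℝ] ℝ) (β : I → ℝ) : Prop :=
  (∃ x ∈ W, ∀ i ∈ T, β i < m i x) ∧ ∀ v ∈ W, (∀ i ∈ T, 0 ≤ m i v) → ∀ i ∈ T, m i v = 0

/-- The sign of the index `i` in the sign vector whose positive part is `P`. -/
noncomputable def cellSign (P : Finset I) (i : I) : ℝ := if i ∈ P then 1 else -1

/-- The cell of the arrangement `l i x = b i`, `i ∈ T`, in `W`, with positive part `P`,
is nonempty and bounded modulo the lineality space. -/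
def IsRelBddRegion (W : Submodule ℝ V) (T : Finset I) (l : I → V →ₗ[ℝ] ℝ) (b : I → ℝ)
    (P : Finset I) : Prop :=
  IsRelBddCell W T (fun i => cellSign P i • l i) (fun i => cellSign P i * b i)

theorem isRelBddCell_insert {W : Submodule ℝ V} {T : Finset I} {m : I → V →ₗ[ℝ] ℝ} {β : I → ℝ}
    {a : I} :
    IsRelBddCell W (insert a T) m β ↔
      (∃ x ∈ W, (∀ i ∈ T, β i < m i x) ∧ β a < m a x) ∧
      ∀ v ∈ W, (∀ i ∈ T, 0 ≤ m i v) → 0 ≤ m a v → (∀ i ∈ T, m i v = 0) ∧ m a v = 0 := by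
  simp only [IsRelBddCell, Finset.forall_mem_insert]
  constructor
  · rintro ⟨⟨x, hx, h1, h2⟩, h⟩
    exact ⟨⟨x, hx, h2, h1⟩, fun v hv h3 h4 => (h v hv ⟨h4, h3⟩).symm⟩
  · rintro ⟨⟨x, hx, h1, h2⟩, h⟩
    exact ⟨⟨x, hx, h2, h1⟩, fun v hv h3 => (h v hv h3.2 h3.1).symm⟩

theorem exists_lt_of_recession {W : Submodule ℝ V} {T : Finset I} {m : I → V →ₗ[ℝ] ℝ} {β : I → ℝ}
    {x v : V} (hxW : x ∈ W) (hx : ∀ i ∈ T, β i < m i x) (hv : v ∈ W) (hmv : ∀ i ∈ T, 0 ≤ m i v)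
    (f : V →ₗ[ℝ] ℝ) (c : ℝ) (hfv : f v < 0) :
    ∃ y ∈ W, (∀ i ∈ T, β i < m i y) ∧ f y < c := by
  have ht : 0 ≤ (|f x - c| + 1) / (-f v) := div_nonneg (by positivity) (by linarith)
  refine ⟨x + ((|f x - c| + 1) / (-f v)) • v, W.add_mem hxW (W.smul_mem _ hv), fun i hi => ?_, ?_⟩
  · have := mul_nonneg ht (hmv i hi)
    have := hx i hi
    simp only [map_add, map_smul, smul_eq_mul]
    linarith
  · have h : (|f x - c| + 1) / (-f v) * f v = -(|f x - c| + 1) := by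
      have := hfv.ne
      field_simp
    have := le_abs_self (f x - c)
    simp only [map_add, map_smul, smul_eq_mul, h]
    linarith

/-- Cutting an open cell by the hyperplane `f x = c`: the two halves together contribute as many
relatively bounded cells as the cell itself and its section by the hyperplane. -/
theorem relBdd_cut {W : Submodule ℝ V} {T : Finset I} {m : I → V →ₗ[ℝ] ℝ} {β : I → ℝ}
    {f : V →ₗ[ℝ] ℝ} {c : ℝ} (hfc : (∃ w ∈ W, f w ≠ 0) ∨ c ≠ 0)
    (hf : ∀ v ∈ W, (∀ i ∈ T, m i v = 0) → f v = 0) :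
    (if (∃ x ∈ W, (∀ i ∈ T, β i < m i x) ∧ c < f x) ∧
        (∀ v ∈ W, (∀ i ∈ T, 0 ≤ m i v) → 0 ≤ f v → (∀ i ∈ T, m i v = 0) ∧ f v = 0)
      then (1 : ℤ) else 0) +
    (if (∃ x ∈ W, (∀ i ∈ T, β i < m i x) ∧ f x < c) ∧
        (∀ v ∈ W, (∀ i ∈ T, 0 ≤ m i v) → f v ≤ 0 → (∀ i ∈ T, m i v = 0) ∧ f v = 0)
      then 1 else 0) =
    (if IsRelBddCell W T m β then 1 else 0) +
    (if (∃ x ∈ W, (∀ i ∈ T, β i < m i x) ∧ f x = c) ∧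
        (∀ v ∈ W, (∀ i ∈ T, 0 ≤ m i v) → f v = 0 → ∀ i ∈ T, m i v = 0)
      then 1 else 0) := by
  have perturb : ∀ x ∈ W, (∀ i ∈ T, β i < m i x) → ∀ u ∈ W,
      ∃ t : ℝ, 0 < t ∧ ∀ i ∈ T, β i < m i (x + t • u) := by
    intro x _ hx u _
    have h : ∀ᶠ t : ℝ in nhdsWithin 0 (Set.Ioi 0), ∀ i ∈ T, β i < m i (x + t • u) := by
      rw [Filter.eventually_all_finset]
      intro i hi
      have hc : Continuous fun t : ℝ => m i (x + t • u) := by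
        simp only [map_add, map_smul, smul_eq_mul]
        fun_prop
      refine nhdsWithin_le_nhds ((hc.tendsto 0).eventually (lt_mem_nhds ?_))
      simpa using hx i hi
    obtain ⟨t, ht, ht0⟩ := (h.and self_mem_nhdsWithin).exists
    exact ⟨t, ht0, ht⟩
  have hdir : (∃ x ∈ W, (∀ i ∈ T, β i < m i x) ∧ f x = c) → ∃ w ∈ W, 0 < f w := by
    rintro ⟨x, hxW, -, hxc⟩
    obtain ⟨w, hw, hfw⟩ : ∃ w ∈ W, f w ≠ 0 := hfc.elim id fun h => ⟨x, hxW, hxc.trans_ne h⟩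
    refine ⟨f w • w, W.smul_mem _ hw, ?_⟩
    simpa using mul_self_pos.2 hfw
  have hN0p : (∃ x ∈ W, (∀ i ∈ T, β i < m i x) ∧ f x = c) →
      ∃ x ∈ W, (∀ i ∈ T, β i < m i x) ∧ c < f x := by
    intro h0
    obtain ⟨w, hw, hfw⟩ := hdir h0
    obtain ⟨x, hxW, hx, hxc⟩ := h0
    obtain ⟨t, ht, h⟩ := perturb x hxW hx w hw
    refine ⟨x + t • w, W.add_mem hxW (W.smul_mem _ hw), h, ?_⟩
    have := mul_pos ht hfw
    simp only [map_add, map_smul, smul_eq_mul]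
    linarith
  have hN0n : (∃ x ∈ W, (∀ i ∈ T, β i < m i x) ∧ f x = c) →
      ∃ x ∈ W, (∀ i ∈ T, β i < m i x) ∧ f x < c := by
    intro h0
    obtain ⟨w, hw, hfw⟩ := hdir h0
    obtain ⟨x, hxW, hx, hxc⟩ := h0
    obtain ⟨t, ht, h⟩ := perturb x hxW hx (-w) (W.neg_mem hw)
    refine ⟨x + t • -w, W.add_mem hxW (W.smul_mem _ (W.neg_mem hw)), h, ?_⟩
    have := mul_pos ht hfw
    simp only [map_add, map_smul, map_neg, smul_eq_mul]
    linarith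
  have hNpn : (∃ x ∈ W, (∀ i ∈ T, β i < m i x) ∧ c < f x) →
      (∃ x ∈ W, (∀ i ∈ T, β i < m i x) ∧ f x < c) →
      ∃ x ∈ W, (∀ i ∈ T, β i < m i x) ∧ f x = c := by
    rintro ⟨x, hxW, hx, hxc⟩ ⟨y, hyW, hy, hyc⟩
    have hd : 0 < f x - f y := by linarith
    have hp : 0 < (c - f y) / (f x - f y) := div_pos (by linarith) hd
    have hq : 0 < (f x - c) / (f x - f y) := div_pos (by linarith) hd
    have hpq : (c - f y) / (f x - f y) + (f x - c) / (f x - f y) = 1 := by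
      field_simp
      ring
    refine ⟨((c - f y) / (f x - f y)) • x + ((f x - c) / (f x - f y)) • y,
      W.add_mem (W.smul_mem _ hxW) (W.smul_mem _ hyW), fun i hi => ?_, ?_⟩
    · have h1 := mul_lt_mul_of_pos_left (hx i hi) hp
      have h2 := mul_lt_mul_of_pos_left (hy i hi) hq
      have h3 : β i = (c - f y) / (f x - f y) * β i + (f x - c) / (f x - f y) * β i := by
        rw [← add_mul, hpq, one_mul]
      simp only [map_add, map_smul, smul_eq_mul]
      linarith
    · simp only [map_add, map_smul, smul_eq_mul]
      field_simp
      ring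
  have hN : (∃ x ∈ W, ∀ i ∈ T, β i < m i x) ↔
      (∃ x ∈ W, (∀ i ∈ T, β i < m i x) ∧ c < f x) ∨
      (∃ x ∈ W, (∀ i ∈ T, β i < m i x) ∧ f x < c) := by
    constructor
    · rintro ⟨x, hxW, hx⟩
      rcases lt_trichotomy (f x) c with h | h | h
      · exact Or.inr ⟨x, hxW, hx, h⟩
      · exact Or.inl (hN0p ⟨x, hxW, hx, h⟩)
      · exact Or.inl ⟨x, hxW, hx, h⟩
    · rintro (⟨x, hxW, hx, -⟩ | ⟨x, hxW, hx, -⟩) <;> exact ⟨x, hxW, hx⟩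
  unfold IsRelBddCell
  generalize hNp' : (∃ x ∈ W, (∀ i ∈ T, β i < m i x) ∧ c < f x) = Np at *
  generalize hNn' : (∃ x ∈ W, (∀ i ∈ T, β i < m i x) ∧ f x < c) = Nn at *
  generalize hN0' : (∃ x ∈ W, (∀ i ∈ T, β i < m i x) ∧ f x = c) = N0 at *
  generalize hC0' : (∀ v ∈ W, (∀ i ∈ T, 0 ≤ m i v) → f v = 0 → ∀ i ∈ T, m i v = 0) = C0
  generalize hC' : (∀ v ∈ W, (∀ i ∈ T, 0 ≤ m i v) → ∀ i ∈ T, m i v = 0) = C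
  generalize hCp' : (∀ v ∈ W, (∀ i ∈ T, 0 ≤ m i v) → 0 ≤ f v → (∀ i ∈ T, m i v = 0) ∧ f v = 0) =
    Cp
  generalize hCn' : (∀ v ∈ W, (∀ i ∈ T, 0 ≤ m i v) → f v ≤ 0 → (∀ i ∈ T, m i v = 0) ∧ f v = 0) =
    Cn
  have hCCp : C → Cp := by
    subst hC' hCp'
    exact fun h v hv hmv _ => ⟨h v hv hmv, hf v hv (h v hv hmv)⟩
  have hCCn : C → Cn := by
    subst hC' hCn'
    exact fun h v hv hmv _ => ⟨h v hv hmv, hf v hv (h v hv hmv)⟩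
  have hCp0 : Cp → C0 := by
    subst hC0' hCp'
    exact fun h v hv hmv hfv => (h v hv hmv hfv.ge).1
  have hCn0 : Cn → C0 := by
    subst hC0' hCn'
    exact fun h v hv hmv hfv => (h v hv hmv hfv.le).1
  have hCpn : Cp → Cn → C := by
    subst hC' hCp' hCn'
    intro h1 h2 v hv hmv
    rcases le_total 0 (f v) with h | h
    · exact (h1 v hv hmv h).1
    · exact (h2 v hv hmv h).1
  have hC0pn : C0 → Cp ∨ Cn := by
    subst hC0' hCp' hCn'
    intro h0
    by_contra! hcon
    obtain ⟨⟨u, hu, hmu, hfu, hu'⟩, w, hw, hmw, hfw, hw'⟩ := hcon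
    have hfu' : 0 < f u := lt_of_le_of_ne hfu fun h => hu' (h0 u hu hmu h.symm) h.symm
    have hfw' : f w < 0 := lt_of_le_of_ne hfw fun h => hw' (h0 w hw hmw h) h
    have hz := h0 ((-f w) • u + f u • w) (W.add_mem (W.smul_mem _ hu) (W.smul_mem _ hw))
      (fun i hi => by
        have h1 := mul_nonneg (neg_nonneg.2 hfw) (hmu i hi)
        have h2 := mul_nonneg hfu (hmw i hi)
        simp only [map_add, map_smul, smul_eq_mul]
        linarith)
      (by
        simp only [map_add, map_smul, smul_eq_mul]
        ring)
    refine hfu'.ne' (hf u hu fun i hi => ?_)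
    have h1 := mul_nonneg (neg_nonneg.2 hfw) (hmu i hi)
    have h2 := mul_nonneg hfu (hmw i hi)
    have h3 := hz i hi
    simp only [map_add, map_smul, smul_eq_mul] at h3
    have h4 : -f w * m i u = 0 := by linarith
    exact (mul_eq_zero.1 h4).resolve_left (by linarith)
  -- A cell lying on one side of the hyperplane recedes only towards that side.
  have hp : Np → ¬ Nn → Cp → C := by
    subst hC' hCp' hNp' hNn'
    rintro ⟨x, hxW, hx, -⟩ hn h v hv hmv
    refine (h v hv hmv ?_).1
    by_contra! hfv
    exact hn (exists_lt_of_recession hxW hx hv hmv f c hfv)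
  have hn : Nn → ¬ Np → Cn → C := by
    subst hC' hCn' hNp' hNn'
    rintro ⟨x, hxW, hx, -⟩ hn h v hv hmv
    refine (h v hv hmv ?_).1
    by_contra! hfv
    obtain ⟨y, hy, h1, h2⟩ := exists_lt_of_recession hxW hx hv hmv (-f) (-c) (by simpa using hfv)
    exact hn ⟨y, hy, h1, by simpa using h2⟩
  rw [hN]
  clear hNp' hNn' hN0' hC0' hC' hCp' hCn' hN hdir perturb hf hfc
  by_cases h1 : Np <;> by_cases h2 : Nn <;> by_cases h3 : N0 <;> by_cases h4 : C <;>
    by_cases h5 : Cp <;> by_cases h6 : Cn <;> by_cases h7 : C0 <;> simp_all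

theorem cellSign_insert_self (P : Finset I) (a : I) : cellSign (insert a P) a = 1 := by
  simp [cellSign]

theorem cellSign_insert_of_ne {P : Finset I} {a i : I} (h : i ≠ a) :
    cellSign (insert a P) i = cellSign P i := by
  simp [cellSign, h]

theorem cellSign_of_notMem {P : Finset I} {i : I} (h : i ∉ P) : cellSign P i = -1 := by
  simp [cellSign, h]

theorem cellSign_ne_zero (P : Finset I) (i : I) : cellSign P i ≠ 0 := by
  unfold cellSign
  split_ifs <;> norm_num

theorem mem_cell_iff {l : I → V →ₗ[ℝ] ℝ} {b : I → ℝ} {P : Finset I} {x : V} :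
    (∀ i, cellSign P i * b i < (cellSign P i • l i) x) ↔
      ∀ i, l i x ≠ b i ∧ (i ∈ P ↔ b i < l i x) := by
  refine forall_congr' fun i => ?_
  by_cases h : i ∈ P
  · simpa [cellSign, h] using ne_of_gt
  · simp only [cellSign, h, if_false, LinearMap.smul_apply, smul_eq_mul, neg_one_mul, neg_lt_neg_iff,
      false_iff, not_lt]
    exact ⟨fun h => ⟨h.ne, h.le⟩, fun h => lt_of_le_of_ne h.2 h.1⟩

section Insert

variable {W : Submodule ℝ V} {T : Finset I} {l : I → V →ₗ[ℝ] ℝ} {b : I → ℝ} {a : I} {P : Finset I}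

theorem isRelBddRegion_insert_insert (ha : a ∉ T) :
    IsRelBddRegion W (insert a T) l b (insert a P) ↔
      (∃ x ∈ W, (∀ i ∈ T, cellSign P i * b i < (cellSign P i • l i) x) ∧ b a < l a x) ∧
      ∀ v ∈ W, (∀ i ∈ T, 0 ≤ (cellSign P i • l i) v) → 0 ≤ l a v →
        (∀ i ∈ T, (cellSign P i • l i) v = 0) ∧ l a v = 0 := by
  have h : ∀ i ∈ T, cellSign (insert a P) i = cellSign P i := fun i hi =>
    cellSign_insert_of_ne (ne_of_mem_of_not_mem hi ha)
  rw [IsRelBddRegion, isRelBddCell_insert]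
  simp +contextual only [h, cellSign_insert_self, one_smul, one_mul]

theorem isRelBddRegion_insert (ha : a ∉ P) :
    IsRelBddRegion W (insert a T) l b P ↔
      (∃ x ∈ W, (∀ i ∈ T, cellSign P i * b i < (cellSign P i • l i) x) ∧ l a x < b a) ∧
      ∀ v ∈ W, (∀ i ∈ T, 0 ≤ (cellSign P i • l i) v) → l a v ≤ 0 →
        (∀ i ∈ T, (cellSign P i • l i) v = 0) ∧ l a v = 0 := by
  rw [IsRelBddRegion, isRelBddCell_insert]
  simp [cellSign_of_notMem ha]

/-- Deletion and restriction for a single relatively bounded region. -/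
theorem relBddRegion_insert_add (ha : a ∉ T) (haP : a ∉ P)
    (hfc : (∃ w ∈ W, l a w ≠ 0) ∨ b a ≠ 0)
    (hf : ∀ v ∈ W, (∀ i ∈ T, l i v = 0) → l a v = 0) :
    (if IsRelBddRegion W (insert a T) l b P then (1 : ℤ) else 0) +
      (if IsRelBddRegion W (insert a T) l b (insert a P) then 1 else 0) =
    (if IsRelBddRegion W T l b P then 1 else 0) +
    (if (∃ x ∈ W, (∀ i ∈ T, cellSign P i * b i < (cellSign P i • l i) x) ∧ l a x = b a) ∧
        (∀ v ∈ W, (∀ i ∈ T, 0 ≤ (cellSign P i • l i) v) → l a v = 0 →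
          ∀ i ∈ T, (cellSign P i • l i) v = 0)
      then 1 else 0) := by
  rw [isRelBddRegion_insert_insert ha, isRelBddRegion_insert haP, add_comm]
  have h := relBdd_cut (T := T) (m := fun i => cellSign P i • l i)
    (β := fun i => cellSign P i * b i) hfc fun v hv h => hf v hv fun i hi => by
      simpa [cellSign_ne_zero] using h i hi
  unfold IsRelBddRegion
  convert h

/-- The section of a cell by `l a x = b a`, as a cell of the restricted arrangement. -/
theorem isRelBddRegion_restrict {p : V} (hp : p ∈ W) (hpa : l a p = b a) :
    ((∃ x ∈ W, (∀ i ∈ T, cellSign P i * b i < (cellSign P i • l i) x) ∧ l a x = b a) ∧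
        (∀ v ∈ W, (∀ i ∈ T, 0 ≤ (cellSign P i • l i) v) → l a v = 0 →
          ∀ i ∈ T, (cellSign P i • l i) v = 0)) ↔
      IsRelBddRegion (W ⊓ LinearMap.ker (l a)) T l (fun i => b i - l i p) P := by
  simp only [IsRelBddRegion, IsRelBddCell, Submodule.mem_inf, LinearMap.mem_ker]
  refine and_congr ⟨?_, ?_⟩ ⟨fun h v hv h' => h v hv.1 h' hv.2, fun h v hv h' h'' => h v ⟨hv, h''⟩ h'⟩
  · rintro ⟨x, hx, h, hxa⟩
    refine ⟨x - p, ⟨W.sub_mem hx hp, by simp [hxa, hpa]⟩, fun i hi => ?_⟩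
    have := h i hi
    simp only [LinearMap.smul_apply, smul_eq_mul, map_sub] at this ⊢
    linarith
  · rintro ⟨x, ⟨hx, hxa⟩, h⟩
    refine ⟨x + p, W.add_mem hx hp, fun i hi => ?_, by simp [hxa, hpa]⟩
    have := h i hi
    simp only [LinearMap.smul_apply, smul_eq_mul, map_add] at this ⊢
    linarith

end Insert

theorem finrank_inf_ker_add_one [FiniteDimensional ℝ V] (W : Submodule ℝ V) {f : V →ₗ[ℝ] ℝ} {w : V}
    (hw : w ∈ W) (hfw : f w ≠ 0) :
    Module.finrank ℝ ↥(W ⊓ LinearMap.ker f) + 1 = Module.finrank ℝ W := by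
  have h0 : f.domRestrict W ≠ 0 := fun h => hfw (by simpa using LinearMap.congr_fun h ⟨w, hw⟩)
  rw [← Module.Dual.finrank_ker_add_one_of_ne_zero h0, ← Submodule.map_comap_subtype,
    Submodule.finrank_map_subtype_eq]
  rfl

/-- The number of relatively bounded regions of the arrangement `l i x = b i`, `i ∈ S`, in `W`
is, up to sign, the alternating sum over central subfamilies. -/
theorem sum_isRelBddRegion [FiniteDimensional ℝ V] (l : I → V →ₗ[ℝ] ℝ) (S : Finset I) :
    ∀ (W : Submodule ℝ V) (b : I → ℝ),
      (∑ P ∈ S.powerset, if IsRelBddRegion W S l b P then (1 : ℤ) else 0) =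
        (-1) ^ (Module.finrank ℝ W +
          Module.finrank ℝ ↥(W ⊓ ⨅ i ∈ S, LinearMap.ker (l i))) *
        ∑ B ∈ S.powerset, if ∃ x ∈ W, ∀ i ∈ B, l i x = b i then (-1 : ℤ) ^ B.card else 0 := by
  induction S using Finset.induction_on with
  | empty =>
    intro W b
    have h1 : IsRelBddRegion W ∅ l b ∅ := ⟨⟨0, W.zero_mem, by simp⟩, by simp⟩
    have h2 : ∃ x, x ∈ W := ⟨0, W.zero_mem⟩
    simp only [Finset.powerset_empty, Finset.sum_singleton, h1]
    have h3 : W ⊓ ⨅ i ∈ (∅ : Finset I), LinearMap.ker (l i) = W := by simp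
    rw [h3, (Even.add_self _).neg_one_pow]
    simp [h2]
  | insert a T ha ih =>
    intro W b
    have haP : ∀ P ∈ T.powerset, a ∉ P := fun P hP h => ha (Finset.mem_powerset.1 hP h)
    rw [Finset.sum_powerset_insert ha, Finset.sum_powerset_insert ha, ← Finset.sum_add_distrib]
    by_cases hf : ∀ v ∈ W, (∀ i ∈ T, l i v = 0) → l a v = 0
    · have hL : W ⊓ ⨅ i ∈ insert a T, LinearMap.ker (l i) = W ⊓ ⨅ i ∈ T, LinearMap.ker (l i) := by
        ext v
        simp only [Submodule.mem_inf, Submodule.mem_iInf, LinearMap.mem_ker,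
          Finset.forall_mem_insert]
        exact ⟨fun h => ⟨h.1, h.2.2⟩, fun h => ⟨h.1, hf v h.1 h.2, h.2⟩⟩
      rw [hL]
      by_cases hw : ∃ w ∈ W, l a w ≠ 0
      · obtain ⟨p, hp, hpa⟩ : ∃ p ∈ W, l a p = b a := by
          obtain ⟨w, hw, hfw⟩ := hw
          exact ⟨(b a / l a w) • w, W.smul_mem _ hw, by simp [hfw]⟩
        have hL' : W ⊓ LinearMap.ker (l a) ⊓ ⨅ i ∈ T, LinearMap.ker (l i) =
            W ⊓ ⨅ i ∈ T, LinearMap.ker (l i) := by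
          rw [← hL, Finset.iInf_insert, inf_assoc]
        have hB : ∀ B ∈ T.powerset,
            (if ∃ x ∈ W, ∀ i ∈ insert a B, l i x = b i then (-1 : ℤ) ^ (insert a B).card else 0) =
            -if ∃ x ∈ W ⊓ LinearMap.ker (l a), ∀ i ∈ B, l i x = b i - l i p
              then (-1 : ℤ) ^ B.card else 0 := by
          intro B hB
          rw [Finset.card_insert_of_notMem (haP B hB), pow_succ]
          have : (∃ x ∈ W, ∀ i ∈ insert a B, l i x = b i) ↔
              ∃ x ∈ W ⊓ LinearMap.ker (l a), ∀ i ∈ B, l i x = b i - l i p := by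
            simp only [Finset.forall_mem_insert, Submodule.mem_inf, LinearMap.mem_ker]
            constructor
            · rintro ⟨x, hx, hxa, h⟩
              exact ⟨x - p, ⟨W.sub_mem hx hp, by simp [hxa, hpa]⟩, fun i hi => by simp [h i hi]⟩
            · rintro ⟨x, ⟨hx, hxa⟩, h⟩
              exact ⟨x + p, W.add_mem hx hp, by simp [hxa, hpa], fun i hi => by simp [h i hi]⟩
          rw [if_congr this rfl rfl]
          split_ifs <;> simp
        rw [Finset.sum_congr rfl fun P hP => relBddRegion_insert_add ha (haP P hP) (.inl hw) hf,
          Finset.sum_congr rfl hB, Finset.sum_add_distrib, ih W b, Finset.sum_neg_distrib]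
        simp only [isRelBddRegion_restrict hp hpa]
        rw [ih, hL']
        obtain ⟨w, hw, hfw⟩ := hw
        rw [← finrank_inf_ker_add_one W hw hfw]
        ring
      · push Not at hw
        by_cases hb : b a = 0
        · have h1 : ∀ P ∈ T.powerset,
              (if IsRelBddRegion W (insert a T) l b P then (1 : ℤ) else 0) +
              (if IsRelBddRegion W (insert a T) l b (insert a P) then 1 else 0) = 0 := by
            intro P hP
            rw [isRelBddRegion_insert_insert ha, isRelBddRegion_insert (haP P hP), if_neg, if_neg,
              add_zero]
            · rintro ⟨⟨x, hx, -, h⟩, -⟩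
              rw [hw x hx, hb] at h
              exact h.false
            · rintro ⟨⟨x, hx, -, h⟩, -⟩
              rw [hw x hx, hb] at h
              exact h.false
          rw [Finset.sum_congr rfl h1, ← Finset.sum_add_distrib, Finset.sum_eq_zero (s := T.powerset)
            (f := fun B => _ + _), Finset.sum_const_zero, mul_zero]
          intro B hB
          rw [Finset.card_insert_of_notMem (haP B hB), pow_succ]
          have : (∃ x ∈ W, ∀ i ∈ insert a B, l i x = b i) ↔ ∃ x ∈ W, ∀ i ∈ B, l i x = b i := by
            simp only [Finset.forall_mem_insert]
            exact ⟨fun ⟨x, hx, h⟩ => ⟨x, hx, h.2⟩,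
              fun ⟨x, hx, h⟩ => ⟨x, hx, (hw x hx).trans hb.symm, h⟩⟩
          rw [if_congr this rfl rfl]
          split_ifs <;> simp
        · have h1 : ∀ x ∈ W, l a x ≠ b a := fun x hx h => hb (h.symm.trans (hw x hx))
          have h2 : ∀ P ∈ T.powerset,
              (if IsRelBddRegion W (insert a T) l b P then (1 : ℤ) else 0) +
              (if IsRelBddRegion W (insert a T) l b (insert a P) then 1 else 0) =
              if IsRelBddRegion W T l b P then 1 else 0 := by
            intro P hP
            rw [relBddRegion_insert_add ha (haP P hP) (.inr hb) hf, add_eq_left, if_neg]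
            rintro ⟨⟨x, hx, -, h⟩, -⟩
            exact h1 x hx h
          have h3 : ∀ B ∈ T.powerset, (if ∃ x ∈ W, ∀ i ∈ insert a B, l i x = b i
              then (-1 : ℤ) ^ (insert a B).card else 0) = 0 := by
            intro B _
            rw [if_neg]
            rintro ⟨x, hx, h⟩
            exact h1 x hx (h a (Finset.mem_insert_self a B))
          rw [Finset.sum_congr rfl h2, Finset.sum_eq_zero h3, add_zero, ih W b]
    · push Not at hf
      obtain ⟨v, hv, hTv, hav⟩ := hf
      have h1 : ∀ P ∈ T.powerset,
          (if IsRelBddRegion W (insert a T) l b P then (1 : ℤ) else 0) +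
          (if IsRelBddRegion W (insert a T) l b (insert a P) then 1 else 0) = 0 := by
        intro P hP
        rw [isRelBddRegion_insert_insert ha, isRelBddRegion_insert (haP P hP), if_neg, if_neg,
          add_zero]
        · rintro ⟨-, h⟩
          have := (h (l a v • v) (W.smul_mem _ hv) (fun i hi => by simp [hTv i hi])
            (by simpa using mul_self_nonneg _)).2
          simp [hav] at this
        · rintro ⟨-, h⟩
          have := (h (-l a v • v) (W.smul_mem _ hv) (fun i hi => by simp [hTv i hi])
            (by simpa using mul_self_nonneg _)).2
          simp [hav] at this
      rw [Finset.sum_congr rfl h1, ← Finset.sum_add_distrib, Finset.sum_eq_zero (s := T.powerset)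
        (f := fun B => _ + _), Finset.sum_const_zero, mul_zero]
      intro B hB
      rw [Finset.card_insert_of_notMem (haP B hB), pow_succ]
      have : (∃ x ∈ W, ∀ i ∈ insert a B, l i x = b i) ↔ ∃ x ∈ W, ∀ i ∈ B, l i x = b i := by
        simp only [Finset.forall_mem_insert]
        refine ⟨fun ⟨x, hx, h⟩ => ⟨x, hx, h.2⟩, fun ⟨x, hx, h⟩ =>
          ⟨x + ((b a - l a x) / l a v) • v, W.add_mem hx (W.smul_mem _ hv), by simp [hav],
            fun i hi => ?_⟩⟩
        simp [h i hi, hTv i (Finset.mem_powerset.1 hB hi)]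
      rw [if_congr this rfl rfl]
      split_ifs <;> simp

end SignVectors

section Topology

variable {E I : Type*} [NormedAddCommGroup E] [NormedSpace ℝ E]

/-- A nonempty open polyhedron with trivial lineality space is bounded if and only if its
recession cone is trivial. -/
theorem isBounded_polyhedron_iff [FiniteDimensional ℝ E] [Fintype I]
    {m : I → E →ₗ[ℝ] ℝ} {β : I → ℝ}
    (hne : ∃ x, ∀ i, β i < m i x) (hL : ∀ v, (∀ i, m i v = 0) → v = 0) :
    Bornology.IsBounded {x | ∀ i, β i < m i x} ↔
      ∀ v, (∀ i, 0 ≤ m i v) → ∀ i, m i v = 0 := by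
  rw [isBounded_iff_forall_norm_le]
  constructor
  · rintro ⟨C, hC⟩ v hv
    obtain ⟨x, hx⟩ := hne
    suffices h : v = 0 by simp [h]
    by_contra hv0
    have hn : 0 < ‖v‖ := norm_pos_iff.2 hv0
    have hC0 : 0 ≤ C := (norm_nonneg x).trans (hC x hx)
    have ht : 0 ≤ (C + ‖x‖ + 1) / ‖v‖ := by positivity
    have h1 := hC (x + ((C + ‖x‖ + 1) / ‖v‖) • v) fun i => by
      have := mul_nonneg ht (hv i)
      have := hx i
      simp only [map_add, map_smul, smul_eq_mul]
      linarith
    have h2 : ‖((C + ‖x‖ + 1) / ‖v‖) • v‖ = C + ‖x‖ + 1 := by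
      rw [norm_smul, Real.norm_of_nonneg ht, div_mul_cancel₀ _ hn.ne']
    have h3 := norm_sub_le (x + ((C + ‖x‖ + 1) / ‖v‖) • v) x
    rw [add_sub_cancel_left, h2] at h3
    linarith
  · intro h
    have hmc : ∀ i, Continuous (m i) := fun i => (m i).continuous_of_finiteDimensional
    have hpos : ∀ v ∈ Metric.sphere (0 : E) 1, 0 < ∑ i, max (-m i v) 0 := by
      intro v hv
      by_contra! hle
      have h0 := (Finset.sum_eq_zero_iff_of_nonneg fun i _ => le_max_right _ _).1
        (hle.antisymm (Finset.sum_nonneg fun i _ => le_max_right (-m i v) 0))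
      have : v = 0 := hL v <| h v fun i => by simpa using h0 i (Finset.mem_univ i)
      simp [this] at hv
    obtain ⟨ε, hε, hle⟩ := (isCompact_sphere (0 : E) 1).exists_forall_le'
      (f := fun v => ∑ i, max (-m i v) 0) (by fun_prop) hpos
    refine ⟨(∑ i, max (-β i) 0) / ε, fun x hx => ?_⟩
    rw [le_div_iff₀ hε]
    have hle' : ∑ i, max (-m i x) 0 ≤ ∑ i, max (-β i) 0 :=
      Finset.sum_le_sum fun i _ => max_le_max_right _ (neg_le_neg (hx i).le)
    rcases eq_or_ne x 0 with rfl | hx0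
    · simpa using Finset.sum_nonneg fun i _ => le_max_right (-β i) 0
    · have hn : 0 < ‖x‖ := norm_pos_iff.2 hx0
      have h1 := hle (‖x‖⁻¹ • x) (by simp [norm_smul, hn.ne'])
      have h2 : ∑ i, max (-m i (‖x‖⁻¹ • x)) 0 = ‖x‖⁻¹ * ∑ i, max (-m i x) 0 := by
        rw [Finset.mul_sum]
        refine Finset.sum_congr rfl fun i _ => ?_
        rw [mul_max_of_nonneg _ _ (by positivity)]
        simp
      rw [h2, inv_mul_eq_div, le_div_iff₀ hn] at h1
      linarith

variable {l : I → E →ₗ[ℝ] ℝ} {b : I → ℝ} {U : Set E}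

theorem image_signFiber [Fintype I] (hU : ∀ x, x ∈ U ↔ ∀ i, l i x ≠ b i)
    (P : Finset I) :
    Subtype.val '' {z : U | Finset.univ.filter (fun i => b i < l i z) = P} =
      {x | ∀ i, cellSign P i * b i < (cellSign P i • l i) x} := by
  ext x
  simp only [Set.mem_image, Set.mem_ofPred_eq, Subtype.exists, exists_and_right, exists_eq_right,
    mem_cell_iff, Finset.ext_iff, Finset.mem_filter, Finset.mem_univ, true_and]
  exact ⟨fun ⟨hx, h⟩ i => ⟨(hU x).1 hx i, (h i).symm⟩,
    fun h => ⟨(hU x).2 fun i => (h i).1, fun i => (h i).2.symm⟩⟩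

/-- Two points of the complement of an arrangement are in the same connected component if and only
if they are on the same side of each hyperplane. -/
theorem connectedComponents_coe_eq_iff [FiniteDimensional ℝ E] [Fintype I]
    (hU : ∀ x, x ∈ U ↔ ∀ i, l i x ≠ b i)
    (x y : U) :
    (x : ConnectedComponents U) = y ↔
      Finset.univ.filter (fun i => b i < l i x) = Finset.univ.filter (fun i => b i < l i y) := by
  constructor
  · intro h
    ext i
    have hc : Continuous fun z : U => l i z :=
      (l i).continuous_of_finiteDimensional.comp continuous_subtype_val
    have hcl : IsClopen {z : U | b i < l i z} := by
      refine ⟨?_, isOpen_lt continuous_const hc⟩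
      have : {z : U | b i < l i z} = {z : U | b i ≤ l i z} := by
        ext z
        simp only [Set.mem_ofPred_eq]
        exact ⟨le_of_lt, fun h => lt_of_le_of_ne h ((hU z).1 z.2 i).symm⟩
      rw [this]
      exact isClosed_le continuous_const hc
    simp only [Finset.mem_filter, Finset.mem_univ, true_and]
    exact ⟨fun hx => hcl.connectedComponent_subset hx (ConnectedComponents.coe_eq_coe'.1 h.symm),
      fun hy => hcl.connectedComponent_subset hy (ConnectedComponents.coe_eq_coe'.1 h)⟩
  · intro h
    have hpre : IsPreconnected {z : U | Finset.univ.filter (fun i => b i < l i z) =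
        Finset.univ.filter (fun i => b i < l i y)} := by
      rw [← Topology.IsInducing.subtypeVal.isPreconnected_image, image_signFiber hU]
      refine Convex.isPreconnected ?_
      rw [Set.ofPred_forall]
      exact convex_iInter fun i => convex_halfSpace_gt (LinearMap.isLinear _) _
    exact ConnectedComponents.coe_eq_coe'.2 (hpre.subset_connectedComponent rfl h)

/-- Components of the complement with a property `p` correspond to sign vectors whose cell is
nonempty with property `p`. -/
theorem card_components_eq [FiniteDimensional ℝ E] [Fintype I]
    (hU : ∀ x, x ∈ U ↔ ∀ i, l i x ≠ b i)
    (p : Set E → Prop) :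
    Nat.card {c : ConnectedComponents U // p (Subtype.val '' (ConnectedComponents.mk ⁻¹' {c}))} =
      Nat.card {P : Finset I // (∃ x, ∀ i, cellSign P i * b i < (cellSign P i • l i) x) ∧
        p {x | ∀ i, cellSign P i * b i < (cellSign P i • l i) x}} := by
  have hfib : ∀ x : U, Subtype.val '' (ConnectedComponents.mk ⁻¹' {(x : ConnectedComponents U)}) =
      {y | ∀ i, cellSign (Finset.univ.filter (fun i => b i < l i x)) i * b i <
        (cellSign (Finset.univ.filter (fun i => b i < l i x)) i • l i) y} := by
    intro x
    rw [← image_signFiber hU]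
    congr 1
    ext z
    exact connectedComponents_coe_eq_iff hU z x
  have hne : ∀ P : Finset I, (∃ x, ∀ i, cellSign P i * b i < (cellSign P i • l i) x) →
      ∃ x : U, Finset.univ.filter (fun i => b i < l i x) = P := by
    rintro P ⟨x, hx⟩
    obtain ⟨z, hz, -⟩ := (image_signFiber hU P).ge hx
    exact ⟨z, hz⟩
  choose g hg using hne
  symm
  refine Nat.card_eq_of_bijective (fun P => ⟨(g P.1 P.2.1 : ConnectedComponents U), ?_⟩) ⟨?_, ?_⟩
  · rw [hfib, hg _ P.2.1]
    exact P.2.2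
  · rintro ⟨P, hP, hP'⟩ ⟨Q, hQ, hQ'⟩ h
    rw [Subtype.mk.injEq, connectedComponents_coe_eq_iff hU, hg P hP, hg Q hQ] at h
    exact Subtype.ext h
  · rintro ⟨c, hc⟩
    obtain ⟨x, rfl⟩ := ConnectedComponents.surjective_coe c
    have hx : ∃ y, ∀ i, cellSign (Finset.univ.filter (fun i => b i < l i x)) i * b i <
        (cellSign (Finset.univ.filter (fun i => b i < l i x)) i • l i) y :=
      ⟨x, (image_signFiber hU _).le ⟨x, rfl, rfl⟩⟩
    refine ⟨⟨Finset.univ.filter (fun i => b i < l i x), hx, by rwa [hfib] at hc⟩, ?_⟩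
    rw [Subtype.mk.injEq, connectedComponents_coe_eq_iff hU, hg _ hx]

theorem finite_components [FiniteDimensional ℝ E] [Finite I]
    (hU : ∀ x, x ∈ U ↔ ∀ i, l i x ≠ b i) :
    Finite (ConnectedComponents U) := by
  have := Fintype.ofFinite I
  obtain ⟨g, hg⟩ := (ConnectedComponents.surjective_coe (α := U)).hasRightInverse
  refine Finite.of_injective (fun c => Finset.univ.filter (fun i => b i < l i (g c)))
    fun c c' h => ?_
  rw [← hg c, ← hg c']
  exact (connectedComponents_coe_eq_iff hU _ _).2 h

end Topology

/-- **Zaslavsky's theorem (bounded regions).** Let `𝒜 = (H i)` be an essential hyperplane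
arrangement in `ℝ^d` (some central subfamily has rank `d`, i.e. a point as intersection).
Then the number of bounded connected components of the complement equals
`(-1)^d Σ_{B central} (-1)^|B| = (-1)^d χ(𝒜; 1)`. -/
theorem zaslavsky_bounded_regions
    {d : ℕ} {I : Type} [Fintype I]
    (l : I → ((Fin d → ℝ) →ₗ[ℝ] ℝ)) (hl : ∀ i, l i ≠ 0) (b : I → ℝ)
    (H : I → Set (Fin d → ℝ)) (hH : ∀ i, H i = {x | l i x = b i})
    (hess : ∃ B : Finset I, (⋂ i ∈ B, H i).Nonempty ∧
      d - Module.finrank ℝ ↥((affineSpan ℝ (⋂ i ∈ B, H i)).direction) = d) :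
    {c : ConnectedComponents ↥((⋃ i, H i)ᶜ) |
        Bornology.IsBounded (Subtype.val '' (ConnectedComponents.mk ⁻¹' {c}))}.Finite ∧
    (Nat.card {c : ConnectedComponents ↥((⋃ i, H i)ᶜ) //
        Bornology.IsBounded (Subtype.val '' (ConnectedComponents.mk ⁻¹' {c}))} : ℤ)
      = (-1) ^ d *
          ∑ B : Finset I,
            if (⋂ i ∈ B, H i).Nonempty then (-1 : ℤ) ^ B.card else 0 := by
  have hmem : ∀ (B : Finset I) (x : Fin d → ℝ), x ∈ ⋂ i ∈ B, H i ↔ ∀ i ∈ B, l i x = b i := by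
    simp [hH]
  have hU : ∀ x, x ∈ (⋃ i, H i)ᶜ ↔ ∀ i, l i x ≠ b i := by simp [hH]
  have hL : ∀ v, (∀ i, l i v = 0) → v = 0 := by
    intro v hv
    obtain ⟨B, ⟨x, hx⟩, hB⟩ := hess
    rcases Nat.eq_zero_or_pos d with rfl | hd
    · exact Subsingleton.elim _ _
    · have hdir : (affineSpan ℝ (⋂ i ∈ B, H i)).direction = ⊥ :=
        Submodule.finrank_eq_zero.1 (by omega)
      have hxv : x + v ∈ ⋂ i ∈ B, H i :=
        (hmem B _).2 fun i hi => by rw [map_add, hv, add_zero, (hmem B x).1 hx i hi]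
      have := AffineSubspace.vsub_mem_direction (subset_affineSpan ℝ _ hxv)
        (subset_affineSpan ℝ _ hx)
      rw [hdir, Submodule.mem_bot] at this
      simpa using this
  have hfin := finite_components hU
  refine ⟨Set.toFinite _, ?_⟩
  have hreg : ∀ P : Finset I,
      ((∃ x, ∀ i, cellSign P i * b i < (cellSign P i • l i) x) ∧
        Bornology.IsBounded {x | ∀ i, cellSign P i * b i < (cellSign P i • l i) x}) ↔
      IsRelBddRegion ⊤ Finset.univ l b P := by
    intro P
    have : IsRelBddRegion ⊤ Finset.univ l b P ↔
        (∃ x, ∀ i, cellSign P i * b i < (cellSign P i • l i) x) ∧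
        ∀ v, (∀ i, 0 ≤ (cellSign P i • l i) v) → ∀ i, (cellSign P i • l i) v = 0 := by
      simp only [IsRelBddRegion, IsRelBddCell, Submodule.mem_top, Finset.mem_univ, true_and,
        forall_true_left]
    rw [this]
    refine and_congr_right fun hne => isBounded_polyhedron_iff hne fun v hv => hL v fun i => ?_
    simpa [cellSign_ne_zero] using hv i
  have hbot : (⊤ : Submodule ℝ (Fin d → ℝ)) ⊓ ⨅ i ∈ Finset.univ, LinearMap.ker (l i) = ⊥ := by
    rw [eq_bot_iff]
    intro v hv
    simp only [Submodule.mem_inf, Submodule.mem_iInf, LinearMap.mem_ker, Finset.mem_univ,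
      forall_true_left] at hv
    exact hL v hv.2
  have hsum := sum_isRelBddRegion l Finset.univ ⊤ b
  rw [hbot, finrank_bot, finrank_top, Module.finrank_fin_fun, add_zero, Finset.powerset_univ]
    at hsum
  rw [card_components_eq hU, Nat.card_congr (Equiv.subtypeEquivRight hreg), Nat.card_eq_fintype_card,
    Fintype.card_subtype, ← Finset.sum_boole, hsum]
  refine congrArg _ (Finset.sum_congr rfl fun B _ => if_congr ?_ rfl rfl)
  simp only [Set.Nonempty, hmem, Submodule.mem_top, true_and]
end

section
/- Let G be a simple graph on the finite vertex set V. An acyclic orientation of G is a relation R on V such that: R u v implies that u and v are adjacent in G; for every pair of adjacent vertices u, v exactly one of R u v and R v u holds; and there is no vertex u with (u,u) in the transitive closure of R (no directed cycles). Then the number of connected components of the open set {x ∈ ℝ^V : x_u ≠ x_v for every edge uv of G} (the complement of the graphical arrangement 𝒜_G) equals the number of acyclic orientations of G. -/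
/-- The orientation of `G` induced by a labelling of the vertices: edges point towards the larger
label. -/
def SimpleGraph.inducedOrientation {V : Type*} (G : SimpleGraph V) (x : V → ℝ) (u v : V) : Prop :=
  G.Adj u v ∧ x u < x v

theorem SimpleGraph.inducedOrientation_not_transGen_self {V : Type*} (G : SimpleGraph V)
    (x : V → ℝ) (u : V) : ¬ Relation.TransGen (G.inducedOrientation x) u u := by
  intro h
  have key : ∀ w, Relation.TransGen (G.inducedOrientation x) u w → x u < x w := by
    intro w hw
    induction hw with
    | single h => exact h.2
    | tail _ h ih => exact ih.trans h.2
  exact lt_irrefl _ (key u h)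

/-- An acyclic relation on a finite type admits a strictly increasing real labelling. -/
theorem exists_real_labelling_of_acyclic {V : Type*} [Finite V] {R : V → V → Prop}
    (hR : ∀ u, ¬ Relation.TransGen R u u) : ∃ x : V → ℝ, ∀ u v, R u v → x u < x v := by
  refine ⟨fun u => ({w | Relation.TransGen R w u}.ncard : ℝ), fun u v huv => ?_⟩
  refine Nat.cast_lt.2 <| Set.ncard_lt_ncard
    ⟨fun w (hw : Relation.TransGen R w u) => hw.tail huv,
      fun h => hR u (h (Relation.TransGen.single huv))⟩

theorem SimpleGraph.isLocallyConstant_inducedOrientation {V : Type*} [Finite V]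
    (G : SimpleGraph V) :
    IsLocallyConstant fun x : ↥{x : V → ℝ | ∀ u v, G.Adj u v → x u ≠ x v} =>
      G.inducedOrientation x.1 := by
  rw [IsLocallyConstant.iff_eventually_eq]
  intro x
  have hlt : ∀ u v, x.1 u < x.1 v → ∀ᶠ y in nhds x, y.1 u < y.1 v := fun u v h =>
    ((continuous_apply u).comp continuous_subtype_val).continuousAt.eventually_lt
      ((continuous_apply v).comp continuous_subtype_val).continuousAt h
  have h : ∀ᶠ y in nhds x, ∀ u v, G.Adj u v → (y.1 u < y.1 v ↔ x.1 u < x.1 v) := by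
    refine Filter.eventually_all.2 fun u => Filter.eventually_all.2 fun v => ?_
    by_cases huv : G.Adj u v
    · rcases lt_or_gt_of_ne (x.2 u v huv) with h | h
      · filter_upwards [hlt u v h] with y hy _ using iff_of_true hy h
      · filter_upwards [hlt v u h] with y hy _ using iff_of_false hy.not_gt h.not_gt
    · exact Filter.Eventually.of_forall fun y h => absurd h huv
  filter_upwards [h] with y hy
  funext u v
  exact propext (and_congr_right (hy u v))

/-- Two points of the complement of the graphical arrangement that induce the same orientation
lie in the same connected component. -/
theorem SimpleGraph.mem_connectedComponent_of_inducedOrientation_eq {V : Type*}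
    (G : SimpleGraph V) {x y : ↥{x : V → ℝ | ∀ u v, G.Adj u v → x u ≠ x v}}
    (h : G.inducedOrientation x.1 = G.inducedOrientation y.1) : y ∈ connectedComponent x := by
  have lt_of_lt : ∀ u v, G.Adj u v → x.1 u < x.1 v → y.1 u < y.1 v := fun u v huv hx =>
    (h ▸ (⟨huv, hx⟩ : G.inducedOrientation x.1 u v) : G.inducedOrientation y.1 u v).2
  have hseg : segment ℝ x.1 y.1 ⊆ {x : V → ℝ | ∀ u v, G.Adj u v → x u ≠ x v} := by
    have hmono : ∀ z ∈ segment ℝ x.1 y.1, ∀ u v, G.Adj u v → x.1 u < x.1 v → z u < z v := by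
      rintro _ ⟨a, b, ha, hb, hab, rfl⟩ u v huv hx
      have hy := lt_of_lt u v huv hx
      simp only [Pi.add_apply, Pi.smul_apply, smul_eq_mul]
      rcases ha.eq_or_lt with rfl | ha
      · simp_all
      · exact add_lt_add_of_lt_of_le (mul_lt_mul_of_pos_left hx ha)
          (mul_le_mul_of_nonneg_left hy.le hb)
    intro z hz u v huv
    rcases lt_or_gt_of_ne (x.2 u v huv) with h | h
    · exact (hmono z hz u v huv h).ne
    · exact (hmono z hz v u huv.symm h).ne'
  have hpre := (convex_segment (𝕜 := ℝ) x.1 y.1).isPreconnected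
  rw [← Set.inter_eq_right.2 hseg, ← Subtype.image_preimage_coe, Topology.IsInducing.subtypeVal.isPreconnected_image]
    at hpre
  exact hpre.subset_connectedComponent (left_mem_segment ℝ x.1 y.1) (right_mem_segment ℝ x.1 y.1)


/-- **Regions of the graphical arrangement are acyclic orientations.** Let `G` be a finite
simple graph on `V`.  An acyclic orientation of `G` is a relation `R` on `V` such that
`R u v` only holds for adjacent `u, v`; for adjacent `u, v` exactly one of `R u v`, `R v u`
holds; and the transitive closure of `R` is irreflexive (no directed cycles).  Then the number
of connected components of the complement `{x : V → ℝ | x u ≠ x v for every edge uv}` of the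
graphical arrangement equals the number of acyclic orientations of `G`. -/
theorem graphical_regions_eq_acyclic_orientations {V : Type} [Fintype V] (G : SimpleGraph V) :
    Nat.card (ConnectedComponents ↥{x : V → ℝ | ∀ u v, G.Adj u v → x u ≠ x v})
      = Nat.card {R : V → V → Prop //
          (∀ u v, R u v → G.Adj u v) ∧
          (∀ u v, G.Adj u v → (R u v ↔ ¬ R v u)) ∧
          (∀ u, ¬ Relation.TransGen R u u)} := by
  let f : ↥{x : V → ℝ | ∀ u v, G.Adj u v → x u ≠ x v} → {R : V → V → Prop //
      (∀ u v, R u v → G.Adj u v) ∧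
      (∀ u v, G.Adj u v → (R u v ↔ ¬ R v u)) ∧
      (∀ u, ¬ Relation.TransGen R u u)} := fun x =>
    ⟨G.inducedOrientation x.1, fun _ _ h => h.1,
      fun u v huv => ⟨fun h h' => lt_asymm h.2 h'.2, fun h => ⟨huv,
        lt_of_le_of_ne (not_lt.1 fun h' => h ⟨huv.symm, h'⟩) (x.2 u v huv)⟩⟩,
      G.inducedOrientation_not_transGen_self x.1⟩
  have hf : ∀ x y, connectedComponent x = connectedComponent y → f x = f y := fun x y hxy =>
    Subtype.ext (G.isLocallyConstant_inducedOrientation.apply_eq_of_isPreconnected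
      isPreconnected_connectedComponent mem_connectedComponent
      (connectedComponent_eq_iff_mem.1 hxy.symm))
  refine Nat.card_eq_of_bijective
    (Quotient.lift f hf : ConnectedComponents _ → _) ⟨?_, ?_⟩
  · rintro ⟨x⟩ ⟨y⟩ hxy
    exact ConnectedComponents.coe_eq_coe.2 (connectedComponent_eq
      (G.mem_connectedComponent_of_inducedOrientation_eq (congrArg Subtype.val hxy)))
  · rintro ⟨R, hadj, hor, hacyc⟩
    obtain ⟨x, hx⟩ := exists_real_labelling_of_acyclic hacyc
    have hR : ∀ u v, G.Adj u v → x u < x v → R u v := fun u v huv hlt =>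
      (hor u v huv).2 fun h => lt_asymm hlt (hx v u h)
    refine ⟨Quotient.mk _ ⟨x, fun u v huv => ?_⟩, Subtype.ext ?_⟩
    · by_cases h : R u v
      · exact (hx u v h).ne
      · exact (hx v u ((hor v u huv.symm).2 h)).ne'
    · funext u v
      exact propext ⟨fun h => hR u v h.1 h.2, fun h => ⟨hadj u v h, hx u v h⟩⟩
end

section
/- (Characteristic polynomial of the Shi arrangement.) Let n ≥ 1 and let Shi_{n−1} be the arrangement in ℚ^n consisting of the hyperplanes {x : x_i − x_j = 0} and {x : x_i − x_j = 1} for 1 ≤ i < j ≤ n. Then, in ℤ[q], Σ_{ℬ ⊆ Shi_{n−1} central} (−1)^{|ℬ|} q^{n−r(ℬ)} = q·(q−n)^{n−1}, i.e., χ(Shi_{n−1}; q) = q(q−n)^{n−1}. -/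
open Polynomial
open scoped Classical

/-- The rank `r(B) = d - dim ⋂_{i ∈ B} H i` of a subfamily `B` of an arrangement `H` in `ℚ^d`,
where the dimension of the (affine-subspace) intersection is the rank of the direction of its
affine span. -/
noncomputable def arrRank {d : ℕ} {I : Type} (H : I → Set (Fin d → ℚ)) (B : Finset I) : ℕ :=
  d - Module.finrank ℚ ↥((affineSpan ℚ (⋂ i ∈ B, H i)).direction)

/-- Solutions over `A` of the equations `x (e i).1 - x (e i).2 = c i`, `i ∈ B`. -/
def gainSolutions {V I : Type} (e : I → V × V) (c : I → ℤ) (A : Type) [Ring A] (B : Finset I) :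
    Set (V → A) :=
  {x | ∀ i ∈ B, x (e i).1 - x (e i).2 = (c i : A)}

/-- Two vertices are related if an edge of `B` goes from the first to the second. -/
def edgeRel {V I : Type} (e : I → V × V) (B : Finset I) (a b : V) : Prop :=
  ∃ i ∈ B, e i = (a, b)

/-- The potentials on `V` that are constant along the edges of `B`. -/
def constantPotentials {V I : Type} (e : I → V × V) (A : Type) [Ring A] (B : Finset I) :
    Submodule A (V → A) where
  carrier := {x | ∀ i ∈ B, x (e i).1 = x (e i).2}
  add_mem' := fun hx hy i hi => by simp [hx i hi, hy i hi]
  zero_mem' := fun i _ => by simp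
  smul_mem' := fun a x hx i hi => by simp [hx i hi]

/-- Potentials constant along the edges are functions on the connected components. -/
def constantPotentialsEquiv {V I : Type} (e : I → V × V) (A : Type) [Ring A] (B : Finset I) :
    constantPotentials e A B ≃ₗ[A] (Quot (edgeRel e B) → A) where
  toFun x := Quot.lift x.1 (by
    rintro a b ⟨i, hi, h⟩
    have := x.2 i hi
    rwa [h] at this)
  invFun y := ⟨fun v => y (Quot.mk _ v), fun i hi => congrArg y (Quot.sound ⟨i, hi, rfl⟩)⟩
  map_add' x y := by
    ext q
    induction q using Quot.ind
    rfl
  map_smul' a x := by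
    ext q
    induction q using Quot.ind
    rfl
  left_inv x := rfl
  right_inv y := by
    ext q
    induction q using Quot.ind
    rfl

section GainGraph

variable {V I : Type} (e : I → V × V) (c : I → ℤ) (B : Finset I)

lemma mem_gainSolutions_iff_sub_mem {A : Type} [Ring A] {x₀ : V → A}
    (h₀ : x₀ ∈ gainSolutions e c A B) (x : V → A) :
    x ∈ gainSolutions e c A B ↔ x - x₀ ∈ constantPotentials e A B := by
  refine forall₂_congr fun i hi => ?_
  have := h₀ i hi
  simp only [Pi.sub_apply]
  rw [← this]
  constructor <;> intro h <;> rw [sub_eq_sub_iff_add_eq_add] at h ⊢ <;> rw [h] <;> abel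

lemma finrank_direction_gainSolutions [Finite V] (h : (gainSolutions e c ℚ B).Nonempty) :
    Module.finrank ℚ (affineSpan ℚ (gainSolutions e c ℚ B)).direction =
      Nat.card (Quot (edgeRel e B)) := by
  obtain ⟨x₀, h₀⟩ := h
  have hcoset : gainSolutions e c ℚ B = (AffineSubspace.mk' x₀ (constantPotentials e ℚ B) : Set _) := by
    ext x
    rw [mem_gainSolutions_iff_sub_mem e c B h₀, SetLike.mem_coe, AffineSubspace.mem_mk']
    rfl
  have : Finite (Quot (edgeRel e B)) := Finite.of_surjective _ Quot.mk_surjective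
  have := Fintype.ofFinite (Quot (edgeRel e B))
  rw [hcoset, AffineSubspace.affineSpan_coe, AffineSubspace.direction_mk',
    (constantPotentialsEquiv e ℚ B).finrank_eq, Module.finrank_fintype_fun_eq_card,
    Nat.card_eq_fintype_card]

lemma card_gainSolutions_zmod [Finite V] (m : ℕ) (h : (gainSolutions e c (ZMod m) B).Nonempty) :
    Nat.card (gainSolutions e c (ZMod m) B) = m ^ Nat.card (Quot (edgeRel e B)) := by
  obtain ⟨x₀, h₀⟩ := h
  have E : gainSolutions e c (ZMod m) B ≃ constantPotentials e (ZMod m) B :=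
    (Equiv.subRight x₀).subtypeEquiv fun x => mem_gainSolutions_iff_sub_mem e c B h₀ x
  rw [Nat.card_congr (E.trans (constantPotentialsEquiv e (ZMod m) B).toEquiv), Nat.card_fun,
    Nat.card_zmod]

lemma gainSolutions_zmod_nonempty (m : ℕ) (h : (gainSolutions e c ℚ B).Nonempty) :
    (gainSolutions e c (ZMod m) B).Nonempty := by
  obtain ⟨x, hx⟩ := h
  refine ⟨fun v => ((⌊x v⌋ : ℤ) : ZMod m), fun i hi => ?_⟩
  have h1 : x (e i).1 = x (e i).2 + (c i : ℤ) := by rw [← hx i hi]; ring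
  have h2 : ⌊x (e i).1⌋ = ⌊x (e i).2⌋ + c i := by rw [h1, Int.floor_add_intCast]
  simp [h2]

/-- With gains `0` and `1`, a solution modulo a number exceeding the number of vertices misses
a residue, hence can be cut open there and lifted to `ℚ`. -/
lemma gainSolutions_rat_nonempty [Fintype V] (hc : ∀ i, c i = 0 ∨ c i = 1) (m : ℕ)
    (hm : Fintype.card V < m) (h : (gainSolutions e c (ZMod m) B).Nonempty) :
    (gainSolutions e c ℚ B).Nonempty := by
  obtain ⟨x, hx⟩ := h
  have : NeZero m := ⟨by omega⟩
  obtain ⟨t, ht⟩ : ∃ t, ∀ v, x v ≠ t := by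
    by_contra! hs
    have := Fintype.card_le_of_surjective x hs
    rw [ZMod.card] at this
    omega
  refine ⟨fun v => ((x v - t - 1).val : ℚ), fun i hi => ?_⟩
  have h1 : x (e i).1 = x (e i).2 + (c i : ZMod m) := by rw [← hx i hi]; ring
  rcases hc i with h0 | h0
  · simp [h1, h0]
  · have hne : (x (e i).2 - t - 1) ≠ -1 := by
      intro h
      apply ht (e i).2
      linear_combination h
    have h2 : x (e i).1 - t - 1 = (x (e i).2 - t - 1) + 1 := by rw [h1, h0]; push_cast; ring
    have h3 : (x (e i).2 - t - 1).val + 1 < m := by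
      refine lt_of_le_of_ne (ZMod.val_lt _) fun h => hne ?_
      rw [eq_neg_iff_add_eq_zero]
      rw [← ZMod.natCast_zmod_val (x (e i).2 - t - 1)]
      have := congrArg (Nat.cast : ℕ → ZMod m) h
      simpa using this
    have h4 : (x (e i).1 - t - 1).val = (x (e i).2 - t - 1).val + 1 := by
      rw [h2]
      have : x (e i).2 - t - 1 + 1 = (((x (e i).2 - t - 1).val + 1 : ℕ) : ZMod m) := by
        simp
      rw [this, ZMod.val_cast_of_lt h3]
    simp only [h4, h0]
    push_cast
    ring

end GainGraph

/-- Inclusion-exclusion over all subfamilies of a gain graph. -/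
lemma sum_neg_one_pow_card_gainSolutions {V I : Type} [Fintype V] [Fintype I]
    (e : I → V × V) (c : I → ℤ) (m : ℕ) [NeZero m] :
    ∑ B : Finset I, (-1 : ℤ) ^ B.card * (Nat.card (gainSolutions e c (ZMod m) B) : ℤ) =
      Nat.card {x : V → ZMod m // ∀ i, x (e i).1 - x (e i).2 ≠ (c i : ZMod m)} := by
  have h1 : ∀ B : Finset I, (Nat.card (gainSolutions e c (ZMod m) B) : ℤ) =
      ∑ x : V → ZMod m, if B ⊆ Finset.univ.filter
        (fun i => x (e i).1 - x (e i).2 = (c i : ZMod m)) then 1 else 0 := by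
    intro B
    rw [Finset.sum_boole, Nat.card_eq_fintype_card, Fintype.card_ofFinset]
    congr 2
    ext x
    rw [Finset.mem_filter, Finset.mem_filter]
    simp [Finset.subset_iff, gainSolutions]
  simp_rw [h1, Finset.mul_sum]
  rw [Finset.sum_comm, Nat.card_eq_fintype_card, Fintype.card_subtype, Finset.card_filter]
  push_cast
  refine Finset.sum_congr rfl fun x _ => ?_
  simp_rw [mul_ite, mul_one, mul_zero]
  rw [← Finset.sum_filter]
  have h2 : (Finset.univ.filter fun B : Finset I => B ⊆ Finset.univ.filter
      (fun i => x (e i).1 - x (e i).2 = (c i : ZMod m))) = (Finset.univ.filter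
      (fun i => x (e i).1 - x (e i).2 = (c i : ZMod m))).powerset := by
    ext B
    simp
  rw [h2, Finset.sum_powerset_neg_one_pow_card]
  simp [Finset.filter_eq_empty_iff]

/-- Placements of `k` labels in distinct cells of a row of `M` cells such that no label is
immediately followed by a smaller one. -/
abbrev ShiPlacement (k M : ℕ) : Type :=
  {z : Fin k → Fin M // ∀ i j, i < j → (z i : ℕ) ≠ z j ∧ (z i : ℕ) ≠ z j + 1}

/-- Insert a new largest label, in a new cell at position `p`. -/
def insertLargest {k M : ℕ} (p : Fin (M + 1)) (z : Fin k → Fin M) : Fin (k + 1) → Fin (M + 1) :=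
  Fin.snoc (α := fun _ => Fin (M + 1)) (fun i => p.succAbove (z i)) p

/-- The largest label is followed by an empty cell or by the end of the row, so it can be removed
together with its cell. -/
lemma insertLargest_valid_iff {k M : ℕ} (p : Fin (M + 1)) (z : Fin k → Fin M) :
    (∀ i j, i < j → (insertLargest p z i : ℕ) ≠ insertLargest p z j ∧
      (insertLargest p z i : ℕ) ≠ insertLargest p z j + 1) ↔
    (∀ i j, i < j → (z i : ℕ) ≠ z j ∧ (z i : ℕ) ≠ z j + 1) ∧ ∀ i, (z i : ℕ) ≠ p := by
  have hv : ∀ a : Fin M, (p.succAbove a : ℕ) = if (a : ℕ) < p then (a : ℕ) else a + 1 := by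
    intro a
    simp only [Fin.succAbove, Fin.lt_def, Fin.val_castSucc]
    split_ifs <;> simp
  constructor
  · intro h
    have hp : ∀ i, (z i : ℕ) ≠ p := by
      intro i
      have := h i.castSucc (Fin.last k) (Fin.castSucc_lt_last i)
      simp only [insertLargest, Fin.snoc_castSucc, Fin.snoc_last, hv] at this
      split_ifs at this <;> omega
    refine ⟨fun i j hij => ?_, hp⟩
    have := h i.castSucc j.castSucc hij
    have hi := hp i
    have hj := hp j
    simp only [insertLargest, Fin.snoc_castSucc, hv] at this
    split_ifs at this <;> omega
  · rintro ⟨h, hp⟩ i j hij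
    induction i using Fin.lastCases with
    | last => exact absurd (Fin.le_last j) (not_le.2 hij)
    | cast i =>
      have hi := hp i
      induction j using Fin.lastCases with
      | last =>
        simp only [insertLargest, Fin.snoc_castSucc, Fin.snoc_last, hv]
        split_ifs <;> omega
      | cast j =>
        have hj := hp j
        have := h i j hij
        simp only [insertLargest, Fin.snoc_castSucc, hv]
        split_ifs <;> omega

lemma card_avoiding_cells {k M : ℕ} (z : ShiPlacement k M) :
    Nat.card {p : Fin (M + 1) // ∀ i, (z.1 i : ℕ) ≠ p} = M + 1 - k := by
  have hinj : Function.Injective fun i => (z.1 i).castSucc := by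
    intro i j h
    have h' : (z.1 i : ℕ) = z.1 j := congrArg Fin.val (Fin.castSucc_injective _ h)
    by_contra hne
    rcases lt_or_gt_of_ne hne with hlt | hlt
    · exact (z.2 i j hlt).1 h'
    · exact (z.2 j i hlt).1 h'.symm
  have h1 : (Finset.univ.filter fun p : Fin (M + 1) => ∀ i, (z.1 i : ℕ) ≠ p) =
      (Finset.univ.image fun i => (z.1 i).castSucc)ᶜ := by
    ext p
    simp [Fin.ext_iff]
  rw [Nat.card_eq_fintype_card, Fintype.card_subtype, h1, Finset.card_compl,
    Finset.card_image_of_injective _ hinj]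
  simp

lemma card_shiPlacement (k t : ℕ) : Nat.card (ShiPlacement k (t + k)) = (t + 1) ^ k := by
  induction k with
  | zero =>
    have : Unique (ShiPlacement 0 (t + 0)) :=
      { default := ⟨Fin.elim0, fun i => i.elim0⟩
        uniq := fun z => Subtype.ext (Subsingleton.elim _ _) }
    rw [Nat.card_unique, pow_zero]
  | succ k ih =>
    let f : (Σ z : ShiPlacement k (t + k), {p : Fin (t + k + 1) // ∀ i, (z.1 i : ℕ) ≠ p}) →
        ShiPlacement (k + 1) (t + k + 1) :=
      fun w => ⟨insertLargest w.2.1 w.1.1, (insertLargest_valid_iff _ _).2 ⟨w.1.2, w.2.2⟩⟩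
    have hf : Function.Bijective f := by
      constructor
      · rintro ⟨⟨z, hz⟩, p, hp⟩ ⟨⟨z', hz'⟩, p', hp'⟩ h
        have h : insertLargest p z = insertLargest p' z' := congrArg Subtype.val h
        obtain rfl : p = p' := by
          simpa [insertLargest] using congrFun h (Fin.last k)
        obtain rfl : z = z' := by
          ext1 i
          simpa [insertLargest] using congrFun h i.castSucc
        rfl
      · rintro ⟨y, hy⟩
        have hex : ∀ i : Fin k, ∃ a, (y (Fin.last k)).succAbove a = y i.castSucc := fun i =>
          Fin.exists_succAbove_eq fun h =>
            (hy i.castSucc (Fin.last k) (Fin.castSucc_lt_last i)).1 (congrArg Fin.val h)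
        choose z hz using hex
        have hyz : insertLargest (y (Fin.last k)) z = y := by
          ext1 i
          induction i using Fin.lastCases with
          | last => simp [insertLargest]
          | cast i => simp [insertLargest, hz]
        rw [← hyz, insertLargest_valid_iff] at hy
        exact ⟨⟨⟨z, hy.1⟩, y (Fin.last k), by simpa [insertLargest] using hy.2⟩,
          Subtype.ext hyz⟩
    rw [← add_assoc, ← Nat.card_eq_of_bijective f hf, Nat.card_sigma]
    simp_rw [card_avoiding_cells]
    rw [Finset.sum_const, Finset.card_univ, ← Nat.card_eq_fintype_card, ih, smul_eq_mul,
      show t + k + 1 - k = t + 1 by omega, pow_succ]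

/-- Points over `ℤ/m` off the Shi arrangement correspond to the position of the largest label
and a linear placement of the other labels in the cells after the (empty) next one. -/
lemma card_zmod_shi_complement (k M : ℕ) :
    Nat.card {x : Fin (k + 1) → ZMod (M + 2) // ∀ i j, i < j → x i - x j ≠ 0 ∧ x i - x j ≠ 1} =
      (M + 2) * Nat.card (ShiPlacement k M) := by
  have hcast : ∀ a b : ℕ, a < M + 2 → b < M + 2 → ((a : ZMod (M + 2)) = b ↔ a = b) := by
    intro a b ha hb
    rw [ZMod.natCast_eq_natCast_iff', Nat.mod_eq_of_lt ha, Nat.mod_eq_of_lt hb]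
  let g : ZMod (M + 2) → (Fin k → Fin M) → Fin (k + 1) → ZMod (M + 2) := fun p z =>
    Fin.snoc (α := fun _ => ZMod (M + 2)) (fun i => p + 2 + ((z i : ℕ) : ZMod (M + 2))) p
  have hg : ∀ p z, (∀ i j, i < j → g p z i - g p z j ≠ 0 ∧ g p z i - g p z j ≠ 1) ↔
      ∀ i j, i < j → (z i : ℕ) ≠ z j ∧ (z i : ℕ) ≠ z j + 1 := by
    intro p z
    have hpair : ∀ i j : Fin k, (g p z i.castSucc - g p z j.castSucc ≠ 0 ∧
        g p z i.castSucc - g p z j.castSucc ≠ 1) ↔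
        (z i : ℕ) ≠ z j ∧ (z i : ℕ) ≠ z j + 1 := by
      intro i j
      rw [ne_eq (z i : ℕ), ne_eq (z i : ℕ), ← hcast (z i) (z j) (by omega) (by omega),
        ← hcast (z i) (z j + 1) (by omega) (by omega)]
      simp only [g, Fin.snoc_castSucc, add_sub_add_left_eq_sub, sub_eq_iff_eq_add, zero_add,
        Nat.cast_add, Nat.cast_one, add_comm (1 : ZMod (M + 2)), ne_eq]
    constructor
    · intro h i j hij
      exact (hpair i j).1 (h _ _ hij)
    · intro h i j hij
      induction i using Fin.lastCases with
      | last => exact absurd (Fin.le_last j) (not_le.2 hij)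
      | cast i =>
        induction j using Fin.lastCases with
        | last =>
          have h0 := (hcast (z i + 2) 0 (by omega) (by omega)).not.2 (by omega)
          have h1 := (hcast (z i + 2) 1 (by omega) (by omega)).not.2 (by omega)
          simp only [g, Fin.snoc_castSucc, Fin.snoc_last]
          push_cast at h0 h1
          exact ⟨fun h => h0 (by linear_combination h), fun h => h1 (by linear_combination h)⟩
        | cast j => exact (hpair i j).2 (h i j hij)
  let f : ZMod (M + 2) × ShiPlacement k M →
      {x : Fin (k + 1) → ZMod (M + 2) // ∀ i j, i < j → x i - x j ≠ 0 ∧ x i - x j ≠ 1} :=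
    fun w => ⟨g w.1 w.2.1, (hg _ _).2 w.2.2⟩
  have hf : Function.Bijective f := by
    constructor
    · rintro ⟨p, z, hz⟩ ⟨p', z', hz'⟩ h
      have h : g p z = g p' z' := congrArg Subtype.val h
      obtain rfl : p = p' := by simpa [g] using congrFun h (Fin.last k)
      obtain rfl : z = z' := by
        ext i
        have := congrFun h i.castSucc
        simp only [g, Fin.snoc_castSucc, add_right_inj] at this
        exact (hcast _ _ (by omega) (by omega)).1 this
      rfl
    · rintro ⟨x, hx⟩
      set p := x (Fin.last k) with hp
      have hMz : ((M : ℕ) : ZMod (M + 2)) + 2 = 0 := by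
        exact_mod_cast ZMod.natCast_self (M + 2)
      have hlt : ∀ i : Fin k, (x i.castSucc - p - 2).val < M := by
        intro i
        obtain ⟨h0, h1⟩ := hx i.castSucc (Fin.last k) (Fin.castSucc_lt_last i)
        rw [← hp] at h0 h1
        have hval := ZMod.natCast_zmod_val (x i.castSucc - p - 2)
        have hle := ZMod.val_lt (x i.castSucc - p - 2)
        by_contra hcon
        obtain h | h : (x i.castSucc - p - 2).val = M ∨ (x i.castSucc - p - 2).val = M + 1 := by
          omega
        · rw [h] at hval
          exact h0 (by linear_combination hMz - hval)
        · rw [h] at hval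
          push_cast at hval
          exact h1 (by linear_combination hMz - hval)
      have hxg : g p (fun i => ⟨_, hlt i⟩) = x := by
        ext1 i
        induction i using Fin.lastCases with
        | last => simp [g, hp]
        | cast i => simp [g]
      rw [← hxg, hg] at hx
      exact ⟨⟨p, _, hx⟩, Subtype.ext hxg⟩
  rw [← Nat.card_eq_of_bijective f hf, Nat.card_prod, Nat.card_zmod]

/-- The characteristic polynomial of a gain graph with gains in `{0, 1}` counts the points over
`ℤ/m` off the arrangement when `m` is large. -/
lemma eval_sum_gainSolutions {n : ℕ} {I : Type} [Fintype I] (e : I → Fin n × Fin n) (c : I → ℤ)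
    (hc : ∀ i, c i = 0 ∨ c i = 1) (H : I → Set (Fin n → ℚ))
    (hH : ∀ i, H i = {x | x (e i).1 - x (e i).2 = (c i : ℚ)}) (m : ℕ) (hm : n < m) :
    eval (m : ℤ) (∑ B : Finset I, if (⋂ i ∈ B, H i).Nonempty then
        (-1 : ℤ[X]) ^ B.card * X ^ (n - arrRank H B) else 0) =
      Nat.card {x : Fin n → ZMod m // ∀ i, x (e i).1 - x (e i).2 ≠ (c i : ZMod m)} := by
  have : NeZero m := ⟨by omega⟩
  have hB : ∀ B : Finset I, ⋂ i ∈ B, H i = gainSolutions e c ℚ B := by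
    intro B
    ext x
    simp [hH, gainSolutions]
  rw [← sum_neg_one_pow_card_gainSolutions, eval_finsetSum]
  refine Finset.sum_congr rfl fun B _ => ?_
  rw [arrRank, hB]
  split_ifs with h
  · have hle : Module.finrank ℚ (affineSpan ℚ (gainSolutions e c ℚ B)).direction ≤ n := by
      simpa using Submodule.finrank_le (affineSpan ℚ (gainSolutions e c ℚ B)).direction
    rw [Nat.sub_sub_self hle, finrank_direction_gainSolutions e c B h,
      card_gainSolutions_zmod e c B m (gainSolutions_zmod_nonempty e c B m h)]
    simp
  · have h' : IsEmpty (gainSolutions e c (ZMod m) B) := by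
      rw [Set.isEmpty_coe_sort, ← Set.not_nonempty_iff_eq_empty]
      exact fun hne => h (gainSolutions_rat_nonempty e c B hc m (by simpa using hm) hne)
    simp

/-- **Characteristic polynomial of the Shi arrangement.** For `n ≥ 1`, the arrangement
`Shi_{n-1}` in `ℚ^n` of the hyperplanes `x i - x j = 0` and `x i - x j = 1` (`i < j`) satisfies
`Σ_{B central} (-1)^|B| q^(n - r B) = q·(q-n)^(n-1)` in `ℤ[q]`. -/
theorem shi_characteristic (n : ℕ) (hn : 1 ≤ n) :
    ∑ B : Finset ({p : Fin n × Fin n // p.1 < p.2} ⊕ {p : Fin n × Fin n // p.1 < p.2}),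
        (if (⋂ i ∈ B, Sum.elim
              (fun p : {p : Fin n × Fin n // p.1 < p.2} =>
                {x : Fin n → ℚ | x p.1.1 - x p.1.2 = 0})
              (fun p : {p : Fin n × Fin n // p.1 < p.2} =>
                {x : Fin n → ℚ | x p.1.1 - x p.1.2 = 1}) i).Nonempty then
          (-1 : Polynomial ℤ) ^ B.card *
            (X : Polynomial ℤ) ^
              (n - arrRank
                (Sum.elim
                  (fun p : {p : Fin n × Fin n // p.1 < p.2} =>
                    {x : Fin n → ℚ | x p.1.1 - x p.1.2 = 0})
                  (fun p : {p : Fin n × Fin n // p.1 < p.2} =>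
                    {x : Fin n → ℚ | x p.1.1 - x p.1.2 = 1})) B)
        else 0)
      = (X : Polynomial ℤ) * ((X : Polynomial ℤ) - (n : Polynomial ℤ)) ^ (n - 1) := by
  obtain ⟨k, rfl⟩ := Nat.exists_eq_add_of_le' hn
  refine Polynomial.eq_of_infinite_eval_eq _ _
    (Set.infinite_of_injective_forall_mem (f := fun t : ℕ => ((t + k + 2 : ℕ) : ℤ)) ?_ ?_)
  · intro a b h
    simp only at h
    omega
  · intro t
    rw [Set.mem_ofPred_eq, eval_sum_gainSolutions
      (Sum.elim (fun p => p.1) (fun p => p.1)) (Sum.elim (fun _ => 0) (fun _ => 1))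
      (by rintro (i | i) <;> simp) _ (by rintro (i | i) <;> simp) _ (by omega)]
    have hcard := card_zmod_shi_complement k (t + k)
    rw [card_shiPlacement] at hcard
    rw [Nat.card_congr (Equiv.subtypeEquivRight (q := fun x : Fin (k + 1) → ZMod (t + k + 2) =>
      ∀ i j, i < j → x i - x j ≠ 0 ∧ x i - x j ≠ 1) fun x => ?_), hcard]
    · simp only [eval_mul, eval_pow, eval_sub, eval_X, eval_natCast, Nat.add_sub_cancel]
      push_cast
      ring
    · simp [Sum.forall, forall_and]
end

section
/- (Characteristic polynomial of the Catalan arrangement.) Let n ≥ 1 and let Cat_{n−1} be the arrangement in ℚ^n consisting of the hyperplanes {x : x_i − x_j = −1}, {x : x_i − x_j = 0}, and {x : x_i − x_j = 1} for 1 ≤ i < j ≤ n. Then, in ℤ[q], Σ_{ℬ ⊆ Cat_{n−1} central} (−1)^{|ℬ|} q^{n−r(ℬ)} = q·(q−n−1)(q−n−2)⋯(q−2n+1) = q·∏_{j=n+1}^{2n−1}(q−j), i.e., χ(Cat_{n−1}; q) = q(q−n−1)(q−n−2)⋯(q−2n+1). -/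
open Polynomial
open scoped Classical

/-! ### Systems of difference equations -/

/-- The difference equations `x (a i) - x (b i) = c i` for `i ∈ B`. -/
def IsDiffSol {n : ℕ} {I R : Type} [Ring R] (a b : I → Fin n) (c : I → ℤ) (B : Finset I)
    (x : Fin n → R) : Prop :=
  ∀ i ∈ B, x (a i) - x (b i) = c i

/-- The relation on indices generated by the equations in `B`. -/
def diffRel {n : ℕ} {I : Type} (a b : I → Fin n) (B : Finset I) (u v : Fin n) : Prop :=
  ∃ i ∈ B, u = a i ∧ v = b i

/-- The solution space of the homogeneous system `x (a i) = x (b i)` for `i ∈ B`. -/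
def diffKer {n : ℕ} {I : Type} (R : Type) [Ring R] (a b : I → Fin n) (B : Finset I) :
    Submodule R (Fin n → R) where
  carrier := {v | ∀ i ∈ B, v (a i) = v (b i)}
  add_mem' hu hv i hi := by simp [hu i hi, hv i hi]
  zero_mem' i _ := rfl
  smul_mem' t v hv i hi := by simp [hv i hi]

/-- Homogeneous solutions are the functions constant on classes of `diffRel`. -/
def diffKerEquiv {n : ℕ} {I : Type} (R : Type) [Ring R] (a b : I → Fin n) (B : Finset I) :
    diffKer R a b B ≃ₗ[R] (Quot (diffRel a b B) → R) where
  toFun v := Quot.lift v.1 (by rintro _ _ ⟨i, hi, rfl, rfl⟩; exact v.2 i hi)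
  map_add' u v := by ext ⟨i⟩; rfl
  map_smul' t v := by ext ⟨i⟩; rfl
  invFun f := ⟨fun i => f (Quot.mk _ i), fun i hi => congrArg f (Quot.sound ⟨i, hi, rfl, rfl⟩)⟩
  left_inv v := rfl
  right_inv f := by ext ⟨i⟩; rfl

lemma sub_mem_diffKer_iff {n : ℕ} {I R : Type} [Ring R] {a b : I → Fin n} {c : I → ℤ}
    {B : Finset I} {x₀ : Fin n → R} (h₀ : IsDiffSol a b c B x₀) (x : Fin n → R) :
    x - x₀ ∈ diffKer R a b B ↔ IsDiffSol a b c B x := by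
  refine forall₂_congr fun i hi => ?_
  rw [← h₀ i hi, Pi.sub_apply, Pi.sub_apply, sub_eq_sub_iff_sub_eq_sub]

lemma finrank_direction_diffSol {n : ℕ} {I : Type} {a b : I → Fin n} {c : I → ℤ}
    {B : Finset I} (h : {x : Fin n → ℚ | IsDiffSol a b c B x}.Nonempty) :
    Module.finrank ℚ (affineSpan ℚ {x : Fin n → ℚ | IsDiffSol a b c B x}).direction =
      Nat.card (Quot (diffRel a b B)) := by
  obtain ⟨x₀, h₀⟩ := h
  have hS : {x : Fin n → ℚ | IsDiffSol a b c B x} =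
      (AffineSubspace.mk' x₀ (diffKer ℚ a b B) : Set (Fin n → ℚ)) := by
    ext x
    exact (sub_mem_diffKer_iff h₀ x).symm
  have : Finite (Quot (diffRel a b B)) := Finite.of_surjective _ Quot.mk_surjective
  have := Fintype.ofFinite (Quot (diffRel a b B))
  rw [hS, AffineSubspace.affineSpan_coe, AffineSubspace.direction_mk',
    (diffKerEquiv ℚ a b B).finrank_eq, Module.finrank_fintype_fun_eq_card, Nat.card_eq_fintype_card]

lemma card_diffSol_of_isDiffSol {n q : ℕ} {I : Type} {a b : I → Fin n} {c : I → ℤ}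
    {B : Finset I} {x₀ : Fin n → ZMod q} (h₀ : IsDiffSol a b c B x₀) :
    Nat.card {x : Fin n → ZMod q // IsDiffSol a b c B x} = q ^ Nat.card (Quot (diffRel a b B)) := by
  have : Finite (Quot (diffRel a b B)) := Finite.of_surjective _ Quot.mk_surjective
  rw [Nat.card_congr ((Equiv.subRight x₀).subtypeEquiv
      fun x => (sub_mem_diffKer_iff h₀ x).symm :
      {x : Fin n → ZMod q // IsDiffSol a b c B x} ≃ diffKer (ZMod q) a b B),
    Nat.card_congr (diffKerEquiv (ZMod q) a b B).toEquiv, Nat.card_fun, Nat.card_zmod]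

lemma exists_diffSol_zmod_of_rat {n : ℕ} (q : ℕ) {I : Type} {a b : I → Fin n} {c : I → ℤ}
    {B : Finset I} {x : Fin n → ℚ} (hx : IsDiffSol a b c B x) :
    IsDiffSol a b c B (fun i => ((⌊x i⌋ : ℤ) : ZMod q)) := by
  intro i hi
  have h : x (a i) = x (b i) + (c i : ℚ) := by linarith [hx i hi]
  simp only [h, Int.floor_add_intCast]
  push_cast
  ring

/-- For small right-hand sides, a solution modulo `q > n` lifts to characteristic zero:
cut the cycle `ZMod q` at a residue which is not attained. -/
lemma exists_diffSol_rat_of_zmod {n q : ℕ} (hq : n < q) {I : Type} {a b : I → Fin n} {c : I → ℤ}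
    (hc : ∀ i, |c i| ≤ 1) {B : Finset I} {x : Fin n → ZMod q} (hx : IsDiffSol a b c B x) :
    ∃ y : Fin n → ℚ, IsDiffSol a b c B y := by
  have : NeZero q := ⟨by omega⟩
  obtain ⟨r, hr⟩ : ∃ r, ∀ i, x i ≠ r := by
    by_contra! h
    have := Fintype.card_le_of_surjective x h
    rw [ZMod.card, Fintype.card_fin] at this
    omega
  refine ⟨fun i => ((x i - r).val : ℚ), fun i hi => ?_⟩
  have hpos : ∀ j, 0 < (x j - r).val ∧ (x j - r).val < q := fun j =>
    ⟨ZMod.val_pos.2 (sub_ne_zero.2 (hr j)), ZMod.val_lt _⟩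
  have h₁ := hpos (a i)
  have h₂ := hpos (b i)
  have hdvd : (q : ℤ) ∣ ((x (a i) - r).val : ℤ) - (x (b i) - r).val - c i := by
    rw [← ZMod.intCast_zmod_eq_zero_iff_dvd]
    push_cast
    rw [ZMod.natCast_zmod_val, ZMod.natCast_zmod_val, ← hx i hi]
    ring
  have h₃ := abs_le.1 (hc i)
  have h₄ : ((x (a i) - r).val : ℤ) - (x (b i) - r).val - c i = 0 :=
    Int.eq_zero_of_abs_lt_dvd hdvd (abs_lt.2 ⟨by omega, by omega⟩)
  have h₅ : ((x (a i) - r).val : ℤ) - (x (b i) - r).val = c i := by omega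
  beta_reduce
  rw [← h₅]
  push_cast
  rfl

lemma card_diffSol {n q : ℕ} (hq : n < q) {I : Type} {a b : I → Fin n} {c : I → ℤ}
    (hc : ∀ i, |c i| ≤ 1) (B : Finset I) :
    Nat.card {x : Fin n → ZMod q // IsDiffSol a b c B x} =
      if {x : Fin n → ℚ | IsDiffSol a b c B x}.Nonempty then
        q ^ Module.finrank ℚ (affineSpan ℚ {x : Fin n → ℚ | IsDiffSol a b c B x}).direction
      else 0 := by
  split_ifs with h
  · rw [finrank_direction_diffSol h]
    obtain ⟨x, hx⟩ := h
    exact card_diffSol_of_isDiffSol (exists_diffSol_zmod_of_rat q hx)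
  · have : IsEmpty {x : Fin n → ZMod q // IsDiffSol a b c B x} :=
      ⟨fun x => h (exists_diffSol_rat_of_zmod hq hc x.2)⟩
    exact Nat.card_of_isEmpty

/-- The finite field method, for arrangements of hyperplanes `x (a i) - x (b i) = c i`
with `|c i| ≤ 1`. -/
lemma sum_central_eval_eq_card {n q : ℕ} (hq : n < q) {I : Type} [Fintype I] {a b : I → Fin n}
    {c : I → ℤ} (hc : ∀ i, |c i| ≤ 1) (H : I → Set (Fin n → ℚ))
    (hH : ∀ i, H i = {x | x (a i) - x (b i) = (c i : ℚ)}) :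
    (∑ B : Finset I, if (⋂ i ∈ B, H i).Nonempty then
        (-1 : Polynomial ℤ) ^ B.card * (X : Polynomial ℤ) ^ (n - arrRank H B) else 0).eval (q : ℤ) =
      Nat.card {x : Fin n → ZMod q // ∀ i, x (a i) - x (b i) ≠ (c i : ZMod q)} := by
  have : NeZero q := ⟨by omega⟩
  have key := Finset.inclusion_exclusion_card_inf_compl (Finset.univ : Finset I)
    (fun i => Finset.univ.filter fun x : Fin n → ZMod q => x (a i) - x (b i) = c i)
  have hl : (Finset.univ.inf fun i => (Finset.univ.filter
      fun x : Fin n → ZMod q => x (a i) - x (b i) = c i)ᶜ) =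
      Finset.univ.filter fun x => ∀ i, x (a i) - x (b i) ≠ (c i : ZMod q) := by
    ext x
    simp [Finset.mem_inf]
  rw [Nat.card_eq_fintype_card, Fintype.card_subtype, ← hl, key, Finset.powerset_univ,
    eval_finsetSum]
  refine Finset.sum_congr rfl fun B _ => ?_
  have hr : (B.inf fun i => Finset.univ.filter
      fun x : Fin n → ZMod q => x (a i) - x (b i) = c i) =
      Finset.univ.filter fun x => IsDiffSol a b c B x := by
    ext x
    simp only [Finset.mem_inf, Finset.mem_filter, Finset.mem_univ, true_and]
    rfl
  have hS : (⋂ i ∈ B, H i) = {x : Fin n → ℚ | IsDiffSol a b c B x} := by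
    ext x
    simp [hH, IsDiffSol]
  have hle : Module.finrank ℚ (affineSpan ℚ {x : Fin n → ℚ | IsDiffSol a b c B x}).direction ≤ n :=
    (Submodule.finrank_le _).trans_eq (by simp)
  rw [hr, ← Fintype.card_subtype, ← Nat.card_eq_fintype_card, card_diffSol hq hc, arrRank, hS,
    Nat.sub_sub_self hle]
  split_ifs <;> simp

/-! ### Counting separated placements -/

/-- The number of indices whose value lies below the value at `i`. -/
noncomputable def belowCount {k : ℕ} (f : Fin k → ℕ) (i : Fin k) : ℕ :=
  (Finset.univ.filter fun j => f j < f i).card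

lemma belowCount_lt {k : ℕ} (f : Fin k → ℕ) (i : Fin k) : belowCount f i < k := by
  have : (Finset.univ.filter fun j => f j < f i) ⊂ Finset.univ :=
    Finset.filter_ssubset.2 ⟨i, Finset.mem_univ i, lt_irrefl _⟩
  simpa [belowCount] using Finset.card_lt_card this

lemma belowCount_lt_belowCount {k : ℕ} {f : Fin k → ℕ} {i j : Fin k} (h : f i < f j) :
    belowCount f i < belowCount f j := by
  refine Finset.card_lt_card (Finset.ssubset_iff_of_subset ?_ |>.2 ⟨i, by simpa using h, by simp⟩)
  intro l
  simpa using fun hl => hl.trans h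

lemma belowCount_congr {k : ℕ} {f g : Fin k → ℕ} (h : ∀ i j, f i < f j ↔ g i < g j) (i : Fin k) :
    belowCount f i = belowCount g i := by
  simp only [belowCount, h]

lemma card_filter_Ico_le {k : ℕ} {f : Fin k → ℕ} (hf : Function.Injective f) (u v : ℕ) :
    (Finset.univ.filter fun l => u ≤ f l ∧ f l < v).card ≤ v - u := by
  rw [← Nat.card_Ico]
  exact Finset.card_le_card_of_injOn f (fun l hl => by simpa using hl) hf.injOn

lemma belowCount_le {k : ℕ} {f : Fin k → ℕ} (hf : Function.Injective f) (i : Fin k) :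
    belowCount f i ≤ f i := by
  simpa [belowCount] using card_filter_Ico_le hf 0 (f i)

/-- No two values of `f` are equal or consecutive. -/
def Separated {k : ℕ} (f : Fin k → ℕ) : Prop :=
  ∀ i j, i ≠ j → f i + 1 < f j ∨ f j + 1 < f i

lemma Separated.injective {k : ℕ} {f : Fin k → ℕ} (hf : Separated f) : Function.Injective f := by
  intro i j h
  by_contra hij
  have := hf i j hij
  omega

lemma Separated.sub_belowCount_lt {k : ℕ} {f : Fin k → ℕ} (hf : Separated f) {i j : Fin k}
    (h : f i < f j) : f i - belowCount f i < f j - belowCount f j := by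
  have hsub : (Finset.univ.filter fun l => f l < f j) ⊆
      (Finset.univ.filter fun l => f l < f i) ∪
        Finset.univ.filter fun l => f i ≤ f l ∧ f l < f j - 1 := by
    intro l
    simp only [Finset.mem_filter, Finset.mem_univ, true_and, Finset.mem_union]
    intro hl
    have := hf l j (by rintro rfl; exact lt_irrefl _ hl)
    omega
  have h₁ := (Finset.card_le_card hsub).trans (Finset.card_union_le _ _)
  have h₂ := card_filter_Ico_le hf.injective (f i) (f j - 1)
  have h₃ := belowCount_le hf.injective i
  have h₄ := belowCount_le hf.injective j
  have h₅ := hf i j (by rintro rfl; exact lt_irrefl _ h)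
  unfold belowCount at *
  omega

lemma sub_belowCount_lt_of_lt {N k : ℕ} {f : Fin k → ℕ} (hf : Function.Injective f)
    (hN : ∀ i, f i < N + k - 1) (i : Fin k) : f i - belowCount f i < N := by
  have hsub : Finset.univ ⊆ (Finset.univ.filter fun l => f l < f i) ∪
      Finset.univ.filter fun l => f i ≤ f l ∧ f l < N + k - 1 := by
    intro l _
    have := hN l
    simp only [Finset.mem_filter, Finset.mem_univ, true_and, Finset.mem_union]
    omega
  have h₁ := (Finset.card_le_card hsub).trans (Finset.card_union_le _ _)
  have h₂ := card_filter_Ico_le hf (f i) (N + k - 1)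
  have h₃ := belowCount_le hf i
  have h₄ := hN i
  rw [Finset.card_univ, Fintype.card_fin] at h₁
  unfold belowCount at *
  omega

lemma add_belowCount_lt_iff {k : ℕ} {g : Fin k → ℕ} (i j : Fin k) :
    g i + belowCount g i < g j + belowCount g j ↔ g i < g j := by
  constructor
  · contrapose!
    intro h
    rcases h.lt_or_eq with h | h
    · have := belowCount_lt_belowCount h
      omega
    · simp [belowCount, h]
  · intro h
    have := belowCount_lt_belowCount h
    omega

lemma Separated.sub_belowCount_lt_iff {k : ℕ} {f : Fin k → ℕ} (hf : Separated f) (i j : Fin k) :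
    f i - belowCount f i < f j - belowCount f j ↔ f i < f j := by
  refine ⟨?_, hf.sub_belowCount_lt⟩
  contrapose!
  intro h
  rcases h.lt_or_eq with h | h
  · exact (hf.sub_belowCount_lt h).le
  · simp [belowCount, h]

lemma card_injective_piFinset_range (N k : ℕ) :
    ((Fintype.piFinset fun _ : Fin k => Finset.range N).filter
      fun g => Function.Injective g).card = N.descFactorial k := by
  rw [← Fintype.card_fin N, ← Fintype.card_fin k, ← Fintype.card_embedding_eq, Fintype.card_fin,
    Fintype.card_fin, ← Finset.card_univ]
  symm
  refine Finset.card_bij (fun e _ i => (e i : ℕ)) ?_ ?_ ?_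
  · intro e _
    simpa [Function.comp_def] using Fin.val_injective.comp e.injective
  · intro e _ e' _ h
    ext i
    exact congrFun h i
  · intro g hg
    simp only [Finset.mem_filter, Fintype.mem_piFinset, Finset.mem_range] at hg
    exact ⟨⟨fun i => ⟨g i, hg.1 i⟩, fun i j h => hg.2 (Fin.mk.inj h)⟩, Finset.mem_univ _, rfl⟩

/-- Injections into `range N` correspond to placements into `range (N + k - 1)` without two equal or
consecutive values, by shifting each value by its rank. -/
lemma card_separated (N k : ℕ) :
    ((Fintype.piFinset fun _ : Fin k => Finset.range (N + k - 1)).filter Separated).card =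
      N.descFactorial k := by
  rw [← card_injective_piFinset_range]
  refine Finset.card_nbij' (fun f i => f i - belowCount f i) (fun g i => g i + belowCount g i)
    ?_ ?_ ?_ ?_
  · intro f hf
    simp only [Finset.coe_filter, Fintype.mem_piFinset, Finset.mem_range, Set.mem_ofPred_eq] at hf ⊢
    refine ⟨sub_belowCount_lt_of_lt hf.2.injective hf.1, fun i j h => hf.2.injective ?_⟩
    have h₁ := hf.2.sub_belowCount_lt_iff i j
    have h₂ := hf.2.sub_belowCount_lt_iff j i
    beta_reduce at h
    omega
  · intro g hg
    simp only [Finset.coe_filter, Fintype.mem_piFinset, Finset.mem_range, Set.mem_ofPred_eq] at hg ⊢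
    refine ⟨fun i => ?_, fun i j hij => ?_⟩
    · have h₁ := hg.1 i
      have h₂ := belowCount_lt g i
      omega
    · beta_reduce
      rcases lt_or_gt_of_ne (hg.2.ne hij) with h | h
      · have := belowCount_lt_belowCount h
        omega
      · have := belowCount_lt_belowCount h
        omega
  · intro f hf
    simp only [Finset.coe_filter, Set.mem_ofPred_eq] at hf
    funext i
    beta_reduce
    rw [belowCount_congr hf.2.sub_belowCount_lt_iff, Nat.sub_add_cancel]
    exact belowCount_le hf.2.injective i
  · intro g _
    funext i
    beta_reduce
    rw [belowCount_congr add_belowCount_lt_iff, Nat.add_sub_cancel]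

lemma ZMod.natCast_sub_natCast_eq_iff {q u v w : ℕ} (hu : u < q) (hv : v + w < q) :
    (u : ZMod q) - v = w ↔ u = v + w := by
  rw [sub_eq_iff_eq_add, add_comm, ← Nat.cast_add, ZMod.natCast_eq_natCast_iff',
    Nat.mod_eq_of_lt hu, Nat.mod_eq_of_lt hv]

lemma cyclic_separated_cons_iff {q k : ℕ} (hq : 2 < q) (r : ZMod q) (v : Fin k → ℕ)
    (hv : ∀ i, v i < q) :
    (∀ i j, i ≠ j → (Fin.cons r fun i => r + v i : Fin (k + 1) → ZMod q) i -
        (Fin.cons r fun i => r + v i : Fin (k + 1) → ZMod q) j ≠ 0 ∧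
      (Fin.cons r fun i => r + v i : Fin (k + 1) → ZMod q) i -
        (Fin.cons r fun i => r + v i : Fin (k + 1) → ZMod q) j ≠ 1) ↔
      (∀ i, 2 ≤ v i ∧ v i < q - 1) ∧ Separated v := by
  have h0 : ∀ i, (v i : ZMod q) = 0 ↔ v i = 0 := fun i => by
    simpa using ZMod.natCast_sub_natCast_eq_iff (v := 0) (w := 0) (hv i) (by omega)
  have h1 : ∀ i, (v i : ZMod q) = 1 ↔ v i = 1 := fun i => by
    simpa using ZMod.natCast_sub_natCast_eq_iff (v := 0) (w := 1) (hv i) (by omega)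
  have h2 : ∀ i, -(v i : ZMod q) = 1 ↔ v i = q - 1 := fun i => by
    have := ZMod.natCast_sub_natCast_eq_iff (v := q - 1) (w := 0) (hv i) (by omega)
    rw [Nat.cast_sub (by omega)] at this
    simp only [CharP.cast_eq_zero, Nat.cast_one, zero_sub, sub_neg_eq_add, add_zero] at this
    rw [← this, neg_eq_iff_add_eq_zero, Nat.cast_zero]
  have h3 : ∀ i j, (v i : ZMod q) - v j = 0 ↔ v i = v j := fun i j => by
    simpa using ZMod.natCast_sub_natCast_eq_iff (v := v j) (w := 0) (hv i) (hv j)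
  have h4 : ∀ i j, v j < q - 1 → ((v i : ZMod q) - v j = 1 ↔ v i = v j + 1) := fun i j hj => by
    simpa using ZMod.natCast_sub_natCast_eq_iff (v := v j) (w := 1) (hv i) (by omega)
  simp only [Fin.forall_fin_succ, Fin.cons_zero, Fin.cons_succ, ne_eq, not_true_eq_false,
    false_implies, true_and, sub_add_cancel_left, add_sub_cancel_left, add_sub_add_left_eq_sub,
    Fin.succ_inj, neg_eq_zero, h0, h1, h2, h3, Fin.succ_ne_zero, (Fin.succ_ne_zero _).symm,
    not_false_eq_true, forall_const]
  constructor
  · rintro ⟨hpos, hsep⟩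
    have hb (i : Fin k) : 2 ≤ v i ∧ v i < q - 1 := by
      have := hpos i
      have := (hsep i).1
      have := hv i
      omega
    refine ⟨hb, fun i j hij => ?_⟩
    have h₁ := (hsep i).2 j hij
    have h₂ := (hsep j).2 i (Ne.symm hij)
    rw [h4 _ _ (hb _).2] at h₁ h₂
    omega
  · rintro ⟨hb, hsep⟩
    refine ⟨fun i => ?_, fun i => ⟨?_, fun j hij => ?_⟩⟩
    · have := hb i
      omega
    · have := hb i
      omega
    · have := hsep i j hij
      rw [h4 _ _ (hb _).2]
      omega

/-- Placements of `k + 1` labelled points on the cycle `ZMod q` without equal or adjacent points. -/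
lemma card_cyclic_separated {q k : ℕ} (hq : 2 * k + 3 ≤ q) :
    Nat.card {x : Fin (k + 1) → ZMod q // ∀ i j, i ≠ j → x i - x j ≠ 0 ∧ x i - x j ≠ 1} =
      q * (q - k - 2).descFactorial k := by
  have : NeZero q := ⟨by omega⟩
  have hN : q - k - 2 + k - 1 = q - 3 := by omega
  have hmul (F : Finset (Fin k → ℕ)) :
      q * F.card = ((Finset.univ : Finset (ZMod q)) ×ˢ F).card := by
    rw [Finset.card_product, Finset.card_univ, ZMod.card]
  rw [Nat.card_eq_fintype_card, Fintype.card_subtype, ← card_separated, hN,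
    hmul]
  symm
  have hcons (x : Fin (k + 1) → ZMod q) :
      (Fin.cons (x 0) fun i => x 0 + ((x (Fin.succ i) - x 0).val : ZMod q)) = x := by
    funext i
    exact Fin.cases rfl (fun i => by simp) i
  refine Finset.card_nbij'
    (fun p => Fin.cons p.1 fun i => p.1 + ((p.2 i + 2 : ℕ) : ZMod q))
    (fun x => (x 0, fun i => (x i.succ - x 0).val - 2)) ?_ ?_ ?_ ?_
  · rintro ⟨r, f⟩ hf
    simp only [Finset.coe_product, Finset.coe_univ, Finset.coe_filter, Fintype.mem_piFinset,
      Finset.mem_range, Set.mem_prod, Set.mem_univ, true_and, Set.mem_ofPred_eq] at hf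
    simp only [Finset.coe_filter, Finset.mem_univ, true_and, Set.mem_ofPred_eq]
    refine (cyclic_separated_cons_iff (by omega) r (fun i => f i + 2) fun i => ?_).2
      ⟨fun i => ?_, fun i j hij => ?_⟩
    · have := hf.1 i
      omega
    · have := hf.1 i
      omega
    · have := hf.2 i j hij
      beta_reduce
      omega
  · intro x hx
    simp only [Finset.coe_filter, Finset.mem_univ, true_and, Set.mem_ofPred_eq] at hx
    rw [← hcons x, cyclic_separated_cons_iff (by omega) _ _ fun i => ZMod.val_lt _] at hx
    simp only [Finset.coe_product, Finset.coe_univ, Finset.coe_filter, Fintype.mem_piFinset,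
      Finset.mem_range, Set.mem_prod, Set.mem_univ, true_and, Set.mem_ofPred_eq]
    refine ⟨fun i => ?_, fun i j hij => ?_⟩
    · have := hx.1 i
      omega
    · have h₁ := hx.1 i
      have h₂ := hx.1 j
      have h₃ := hx.2 i j hij
      beta_reduce at h₃ ⊢
      omega
  · rintro ⟨r, f⟩ hf
    simp only [Finset.coe_product, Finset.coe_univ, Finset.coe_filter, Fintype.mem_piFinset,
      Finset.mem_range, Set.mem_prod, Set.mem_univ, true_and, Set.mem_ofPred_eq] at hf
    refine Prod.ext rfl (funext fun i => ?_)
    have := hf.1 i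
    simp only [Fin.cons_succ, Fin.cons_zero, add_sub_cancel_left]
    rw [ZMod.val_cast_of_lt (by omega), Nat.add_sub_cancel]
  · intro x hx
    simp only [Finset.coe_filter, Finset.mem_univ, true_and, Set.mem_ofPred_eq] at hx
    rw [← hcons x, cyclic_separated_cons_iff (by omega) _ _ fun i => ZMod.val_lt _] at hx
    have h (i : Fin k) : (x i.succ - x 0).val - 2 + 2 = (x i.succ - x 0).val :=
      Nat.sub_add_cancel (hx.1 i).1
    simpa only [h] using hcons x

/-- **Characteristic polynomial of the Catalan arrangement.** For `n ≥ 1`, the arrangement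
`Cat_{n-1}` in `ℚ^n` of the hyperplanes `x i - x j ∈ {-1, 0, 1}` (`i < j`) satisfies
`Σ_{B central} (-1)^|B| q^(n - r B) = q·(q-n-1)(q-n-2)⋯(q-2n+1)` in `ℤ[q]`. -/
theorem catalan_characteristic (n : ℕ) (hn : 1 ≤ n) :
    ∑ B : Finset (({p : Fin n × Fin n // p.1 < p.2} ⊕ {p : Fin n × Fin n // p.1 < p.2}) ⊕
        {p : Fin n × Fin n // p.1 < p.2}),
        (if (⋂ i ∈ B, Sum.elim
              (Sum.elim
                (fun p : {p : Fin n × Fin n // p.1 < p.2} =>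
                  {x : Fin n → ℚ | x p.1.1 - x p.1.2 = -1})
                (fun p : {p : Fin n × Fin n // p.1 < p.2} =>
                  {x : Fin n → ℚ | x p.1.1 - x p.1.2 = 0}))
              (fun p : {p : Fin n × Fin n // p.1 < p.2} =>
                {x : Fin n → ℚ | x p.1.1 - x p.1.2 = 1}) i).Nonempty then
          (-1 : Polynomial ℤ) ^ B.card *
            (X : Polynomial ℤ) ^
              (n - arrRank
                (Sum.elim
                  (Sum.elim
                    (fun p : {p : Fin n × Fin n // p.1 < p.2} =>
                      {x : Fin n → ℚ | x p.1.1 - x p.1.2 = -1})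
                    (fun p : {p : Fin n × Fin n // p.1 < p.2} =>
                      {x : Fin n → ℚ | x p.1.1 - x p.1.2 = 0}))
                  (fun p : {p : Fin n × Fin n // p.1 < p.2} =>
                    {x : Fin n → ℚ | x p.1.1 - x p.1.2 = 1})) B)
        else 0)
      = (X : Polynomial ℤ) *
          ∏ k ∈ Finset.Icc (n + 1) (2 * n - 1), ((X : Polynomial ℤ) - (k : Polynomial ℤ)) := by
  refine Polynomial.eq_of_infinite_eval_eq _ _ (((Set.Ici_infinite (2 * n + 1)).image
    (Nat.cast_injective (R := ℤ)).injOn).mono ?_)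
  rintro _ ⟨q, hq : 2 * n + 1 ≤ q, rfl⟩
  obtain ⟨k, rfl⟩ : ∃ k, n = k + 1 := ⟨n - 1, by omega⟩
  rw [Set.mem_ofPred_eq, sum_central_eval_eq_card (by omega)
    (a := Sum.elim (Sum.elim (fun p => p.1.1) fun p => p.1.1) fun p => p.1.1)
    (b := Sum.elim (Sum.elim (fun p => p.1.2) fun p => p.1.2) fun p => p.1.2)
    (c := Sum.elim (Sum.elim (fun _ => -1) fun _ => 0) fun _ => 1)
    (by rintro ((i | i) | i) <;> simp) _ (by rintro ((i | i) | i) <;> simp)]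
  have hcard : Nat.card {x : Fin (k + 1) → ZMod q // ∀ i j, i ≠ j → x i - x j ≠ 0 ∧ x i - x j ≠ 1} =
      q * (q - k - 2).descFactorial k := card_cyclic_separated (by omega)
  rw [Nat.card_congr (Equiv.subtypeEquivRight (q := fun x : Fin (k + 1) → ZMod q =>
    ∀ i j, i ≠ j → x i - x j ≠ 0 ∧ x i - x j ≠ 1) fun x => ?_), hcard]
  · rw [eval_mul, eval_X, eval_prod, Nat.cast_mul, Nat.descFactorial_eq_prod_range, Nat.cast_prod]
    congr 1
    refine Finset.prod_bij (fun i _ => i + k + 2) ?_ ?_ ?_ ?_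
    · intro i hi
      simp only [Finset.mem_range, Finset.mem_Icc] at hi ⊢
      omega
    · intro i _ j _ h
      omega
    · intro j hj
      simp only [Finset.mem_Icc] at hj
      exact ⟨j - k - 2, by simp only [Finset.mem_range]; omega, by omega⟩
    · intro i hi
      simp only [Finset.mem_range] at hi
      rw [eval_sub, eval_X, eval_natCast]
      omega
  · simp only [Sum.forall, Sum.elim_inl, Sum.elim_inr, Subtype.forall, Prod.forall]
    constructor
    · rintro ⟨⟨hneg, hzero⟩, hone⟩ i j hij
      rcases lt_or_gt_of_ne hij with h | h
      · exact ⟨by simpa using hzero i j h, by simpa using hone i j h⟩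
      · refine ⟨fun h' => hzero j i h ?_, fun h' => hneg j i h ?_⟩
        · rw [← neg_sub, h', neg_zero, Int.cast_zero]
        · rw [← neg_sub, h', Int.cast_neg, Int.cast_one]
    · intro h
      refine ⟨⟨fun i j hij h' => (h j i hij.ne').2 ?_, fun i j hij => ?_⟩, fun i j hij => ?_⟩
      · rw [← neg_sub, h', Int.cast_neg, Int.cast_one, neg_neg]
      · simpa using (h i j hij.ne).1
      · simpa using (h i j hij.ne).2
end

section
/- (Zonotope volume as a Tutte evaluation M(A;1,1).) Let A = (a_i)_{i∈ι} be a finite family of vectors in ℤ^d. Then the Lebesgue measure (volume) of the zonotope Z(A) ⊆ ℝ^d equals Σ_B |det(a_i)_{i∈B}|, where the sum runs over all subsets B ⊆ ι of size d such that the vectors (a_i)_{i∈B} are linearly independent over ℝ, and det(a_i)_{i∈B} is the determinant of the d×d integer matrix whose columns are these vectors (in any fixed order). -/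
open scoped Classical ENNReal
open MeasureTheory Set

/-- The zonotope generated by a finite family of vectors of a real vector space. -/
def zonotope {E : Type*} [AddCommGroup E] [Module ℝ E] {m : ℕ} (A : Fin m → E) : Set E :=
  {x | ∃ lam : Fin m → ℝ, (∀ i, 0 ≤ lam i ∧ lam i ≤ 1) ∧ x = ∑ i, lam i • A i}

/-- The absolute value of the determinant of the subfamily of `A` indexed by `B` (zero unless `B`
has exactly `d` elements). -/
noncomputable def absMinor {d m : ℕ} (A : Fin m → Fin d → ℝ) (B : Finset (Fin m)) : ℝ≥0∞ :=
  if h : B.card = d then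
    ENNReal.ofReal |(Matrix.of fun i j : Fin d => A (B.orderEmbOfFin h j) i).det|
  else 0

section Zonotope

variable {E F : Type*} [AddCommGroup E] [Module ℝ E] [AddCommGroup F] [Module ℝ F] {m : ℕ}

theorem zonotope_eq_image (A : Fin m → E) :
    zonotope A = Fintype.linearCombination ℝ A '' Icc 0 1 := by
  ext x
  simp only [zonotope, mem_ofPred_eq, mem_image, mem_Icc, Pi.le_def, Fintype.linearCombination_apply,
    ← forall_and, eq_comm (a := x), Pi.zero_apply, Pi.one_apply]

theorem image_zonotope (f : E →ₗ[ℝ] F) (A : Fin m → E) :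
    f '' zonotope A = zonotope fun i => f (A i) := by
  simp only [zonotope_eq_image, image_image]
  refine image_congr fun l _ => ?_
  simp only [Fintype.linearCombination_apply, map_sum, map_smul]

theorem convex_zonotope (A : Fin m → E) : Convex ℝ (zonotope A) := by
  rw [zonotope_eq_image]
  exact (convex_Icc _ _).linear_image _

theorem zonotope_nonempty (A : Fin m → E) : (zonotope A).Nonempty :=
  ⟨0, 0, by simp, by simp⟩

theorem isCompact_zonotope {d : ℕ} (A : Fin m → Fin d → ℝ) : IsCompact (zonotope A) := by
  rw [zonotope_eq_image]
  exact isCompact_Icc.image (LinearMap.continuous_of_finiteDimensional _)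

theorem mem_zonotope_succ (A : Fin (m + 1) → E) (x : E) :
    x ∈ zonotope A ↔ ∃ s ∈ Icc (0 : ℝ) 1, x - s • A 0 ∈ zonotope (Fin.tail A) := by
  constructor
  · rintro ⟨l, hl, rfl⟩
    exact ⟨l 0, hl 0, Fin.tail l, fun i => hl i.succ, by simp [Fin.sum_univ_succ, Fin.tail]⟩
  · rintro ⟨s, hs, l, hl, h⟩
    refine ⟨Fin.cons s l, Fin.cases hs hl, ?_⟩
    rw [sub_eq_iff_eq_add] at h
    rw [h, Fin.sum_univ_succ, add_comm]
    simp [Fin.tail]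

theorem zonotope_succ_of_eq_zero (A : Fin (m + 1) → E) (h : A 0 = 0) :
    zonotope A = zonotope (Fin.tail A) := by
  ext x
  rw [mem_zonotope_succ]
  simp only [h, smul_zero, sub_zero]
  exact ⟨fun ⟨_, _, hx⟩ => hx, fun hx => ⟨0, by simp, hx⟩⟩

end Zonotope

theorem Finset.sum_finset_fin_succ {M : Type*} [AddCommMonoid M] {m : ℕ}
    (g : Finset (Fin (m + 1)) → M) :
    ∑ B, g B = ∑ B : Finset (Fin m), g (B.map (Fin.succEmb m)) +
      ∑ B : Finset (Fin m), g (Finset.cons 0 (B.map (Fin.succEmb m)) (by simp)) := by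
  have key : (Finset.univ.map (Fin.succEmb m)).powerset =
      Finset.univ.map (Finset.mapEmbedding (Fin.succEmb m)).toEmbedding := by
    ext s
    simp [Finset.subset_map_iff, eq_comm]
  rw [← Finset.powerset_univ, Fin.univ_succ]
  have h0 : (0 : Fin (m + 1)) ∉ Finset.univ.map (Fin.succEmb m) := by simp
  have := Finset.sum_powerset_insert h0 g
  rw [key, Finset.sum_map, Finset.sum_map] at this
  rw [Finset.cons_eq_insert]
  refine this.trans ?_
  simp [Finset.cons_eq_insert]

section Minor

variable {d m : ℕ}

theorem absMinor_map_succ (A : Fin (m + 1) → Fin d → ℝ) (B : Finset (Fin m)) :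
    absMinor A (B.map (Fin.succEmb m)) = absMinor (Fin.tail A) B := by
  unfold absMinor
  by_cases h : B.card = d
  · have h' : (B.map (Fin.succEmb m)).card = d := by simpa using h
    have key : (fun j => (B.orderEmbOfFin h j).succ) = (B.map (Fin.succEmb m)).orderEmbOfFin h' :=
      Finset.orderEmbOfFin_unique h' (fun x => by simp)
        (Fin.strictMono_succ.comp (B.orderEmbOfFin h).strictMono)
    rw [dif_pos h, dif_pos h']
    simp only [← key, Fin.tail]
  · rw [dif_neg h, dif_neg (by simpa using h)]

theorem absMinor_cons_zero (A : Fin (m + 1) → Fin (d + 1) → ℝ) (B : Finset (Fin m)) :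
    absMinor A (Finset.cons 0 (B.map (Fin.succEmb m)) (by simp)) =
      if h : B.card = d then
        ENNReal.ofReal |(Matrix.of fun i j : Fin (d + 1) =>
          A (Fin.cons (α := fun _ => Fin (m + 1)) 0 (fun j => (B.orderEmbOfFin h j).succ) j) i).det|
      else 0 := by
  unfold absMinor
  by_cases h : B.card = d
  · have h' : (Finset.cons 0 (B.map (Fin.succEmb m)) (by simp)).card = d + 1 := by simpa using h
    have key : (Fin.cons (α := fun _ => Fin (m + 1)) 0 (fun j => (B.orderEmbOfFin h j).succ)) =
        (Finset.cons 0 (B.map (Fin.succEmb m)) (by simp)).orderEmbOfFin h' := by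
      refine Finset.orderEmbOfFin_unique h' (Fin.cases (by simp) fun x => by simp) ?_
      exact Fin.strictMono_cons.2
        ⟨fun i => Fin.succ_pos _, Fin.strictMono_succ.comp (B.orderEmbOfFin h).strictMono⟩
    rw [dif_pos h, dif_pos h']
    simp only [← key]
  · rw [dif_neg h, dif_neg (by simpa using h)]

theorem absMinor_linearMap (f : (Fin d → ℝ) →ₗ[ℝ] (Fin d → ℝ)) (A : Fin m → Fin d → ℝ)
    (B : Finset (Fin m)) :
    absMinor (fun i => f (A i)) B = ENNReal.ofReal |f.det| * absMinor A B := by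
  unfold absMinor
  split_ifs with h
  · rw [← ENNReal.ofReal_mul (abs_nonneg _), ← abs_mul, ← LinearMap.det_toMatrix', ← Matrix.det_mul]
    congr 3
    ext i j
    simp only [Matrix.of_apply, Matrix.mul_apply]
    rw [← LinearMap.toMatrix'_mulVec f]
    rfl
  · simp

theorem absMinor_cons_zero_of_eq_zero (A : Fin (m + 1) → Fin (d + 1) → ℝ) (hA : A 0 = 0)
    (B : Finset (Fin m)) :
    absMinor A (Finset.cons 0 (B.map (Fin.succEmb m)) (by simp)) = 0 := by
  rw [absMinor_cons_zero]
  split_ifs with h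
  · rw [Matrix.det_eq_zero_of_column_eq_zero 0 (by simp [hA])]
    simp
  · rfl

theorem absMinor_cons_zero_of_eq_single (A : Fin (m + 1) → Fin (d + 1) → ℝ)
    (hA : A 0 = Pi.single 0 1) (B : Finset (Fin m)) :
    absMinor A (Finset.cons 0 (B.map (Fin.succEmb m)) (by simp)) =
      absMinor (fun i => Fin.tail (A i.succ)) B := by
  rw [absMinor_cons_zero, absMinor]
  split_ifs with h
  · rw [Matrix.det_succ_column_zero, Fin.sum_univ_succ, Finset.sum_eq_zero]
    · simp only [Matrix.of_apply, Fin.cons_zero, hA, Pi.single_eq_same]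
      simp
      rfl
    · intro i _
      simp [hA]
  · rfl

end Minor

theorem Real.volume_sub_mem_of_isCompact_of_convex {K : Set ℝ} (hK : IsCompact K)
    (hc : Convex ℝ K) (hne : K.Nonempty) :
    volume {t : ℝ | ∃ s ∈ Icc (0 : ℝ) 1, t - s ∈ K} = volume K + 1 := by
  obtain ⟨a, b, hab, rfl⟩ : ∃ a b, a ≤ b ∧ K = Icc a b := by
    have := eq_Icc_of_connected_compact ⟨hne, hc.isPreconnected⟩ hK
    refine ⟨_, _, ?_, this⟩
    rw [← nonempty_Icc, ← this]
    exact hne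
  have : {t : ℝ | ∃ s ∈ Icc (0 : ℝ) 1, t - s ∈ Icc a b} = Icc a (b + 1) := by
    ext t
    simp only [mem_ofPred_eq, mem_Icc]
    constructor
    · rintro ⟨s, hs, ht⟩
      constructor <;> linarith
    · rintro ⟨h1, h2⟩
      rcases le_total t b with h | h
      · exact ⟨0, by simp, by constructor <;> linarith⟩
      · exact ⟨t - b, by constructor <;> linarith, by constructor <;> linarith⟩
  rw [this, Real.volume_Icc, Real.volume_Icc, ← ENNReal.ofReal_one,
    ← ENNReal.ofReal_add (by linarith) zero_le_one]
  congr 1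
  ring

theorem volume_eq_lintegral_cons {d : ℕ} {K : Set (Fin (d + 1) → ℝ)} (hK : MeasurableSet K) :
    volume K = ∫⁻ y : Fin d → ℝ, volume {t : ℝ | (Fin.cons t y : Fin (d + 1) → ℝ) ∈ K} := by
  let e := MeasurableEquiv.piFinSuccAbove (fun _ : Fin (d + 1) => ℝ) 0
  have he : MeasurePreserving e.symm :=
    (volume_preserving_piFinSuccAbove (fun _ : Fin (d + 1) => ℝ) 0).symm
  rw [← he.measure_preimage hK.nullMeasurableSet, Measure.volume_eq_prod,
    Measure.prod_apply_symm (e.symm.measurable hK)]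
  refine lintegral_congr fun y => ?_
  congr 1
  ext t
  simp [e, MeasurableEquiv.piFinSuccAbove, Fin.insertNthEquiv]

theorem volume_zonotope_succ_of_eq_single {d m : ℕ} (A : Fin (m + 1) → Fin (d + 1) → ℝ)
    (hA : A 0 = Pi.single 0 1) :
    volume (zonotope A) =
      volume (zonotope (Fin.tail A)) + volume (zonotope fun i => Fin.tail (A i.succ)) := by
  let p : (Fin (d + 1) → ℝ) →ₗ[ℝ] (Fin d → ℝ) := LinearMap.funLeft ℝ ℝ Fin.succ
  have hp : (zonotope fun i => Fin.tail (A i.succ)) = p '' zonotope (Fin.tail A) :=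
    (image_zonotope p _).symm
  have hmeas := (isCompact_zonotope fun i => Fin.tail (A i.succ)).measurableSet
  rw [volume_eq_lintegral_cons (isCompact_zonotope A).measurableSet,
    volume_eq_lintegral_cons (isCompact_zonotope _).measurableSet,
    ← lintegral_indicator_one hmeas, ← lintegral_add_right _ (measurable_one.indicator hmeas)]
  refine lintegral_congr fun y => ?_
  set K : Set ℝ := {t : ℝ | (Fin.cons t y : Fin (d + 1) → ℝ) ∈ zonotope (Fin.tail A)} with hKdef
  have hfib : {t : ℝ | (Fin.cons t y : Fin (d + 1) → ℝ) ∈ zonotope A} =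
      {t : ℝ | ∃ s ∈ Icc (0 : ℝ) 1, t - s ∈ K} := by
    ext t
    simp only [mem_ofPred_eq, mem_zonotope_succ A, hKdef]
    refine exists_congr fun s => and_congr_right fun _ => ?_
    have : (Fin.cons t y : Fin (d + 1) → ℝ) - s • A 0 = Fin.cons (t - s) y := by
      ext i
      refine Fin.cases ?_ (fun j => ?_) i <;> simp [hA]
    rw [this]
  have hmem : y ∈ (zonotope fun i => Fin.tail (A i.succ)) ↔ K.Nonempty := by
    rw [hp]
    constructor
    · rintro ⟨x, hx, rfl⟩
      refine ⟨x 0, ?_⟩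
      have : (Fin.cons (x 0) (p x) : Fin (d + 1) → ℝ) = x := Fin.cons_self_tail x
      rwa [hKdef, mem_ofPred_eq, this]
    · rintro ⟨t, ht⟩
      exact ⟨_, ht, by ext i; simp [p, LinearMap.funLeft_apply]⟩
  rw [hfib]
  by_cases hne : K.Nonempty
  · rw [indicator_of_mem (hmem.2 hne), Pi.one_apply]
    refine Real.volume_sub_mem_of_isCompact_of_convex ?_ ?_ hne
    · have hcl : IsClosed K :=
        (isCompact_zonotope (Fin.tail A)).isClosed.preimage
          (f := fun t : ℝ => (Fin.cons t y : Fin (d + 1) → ℝ)) (by fun_prop)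
      refine ((isCompact_zonotope (Fin.tail A)).image (continuous_apply 0)).of_isClosed_subset hcl ?_
      exact fun t ht => ⟨_, ht, rfl⟩
    · intro s hs t ht a b ha hb hab
      have := convex_zonotope (Fin.tail A) hs ht ha hb hab
      rw [hKdef, mem_ofPred_eq]
      convert this using 1
      ext i
      refine Fin.cases ?_ (fun j => ?_) i
      · simp
      · simp [← add_mul, hab]
  · rw [indicator_of_notMem (fun h => hne (hmem.1 h))]
    rw [not_nonempty_iff_eq_empty] at hne
    simp [hne]

theorem volume_zonotope_eq_sum_absMinor {d m : ℕ} (A : Fin m → Fin d → ℝ) :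
    volume (zonotope A) = ∑ B, absMinor A B := by
  induction m generalizing d with
  | zero =>
    have hZ : zonotope A = {0} := by
      ext x
      simp [zonotope]
    rw [hZ, ← Finset.powerset_univ, Finset.univ_eq_empty, Finset.powerset_empty,
      Finset.sum_singleton]
    rcases d with _ | d
    · simp [absMinor, volume_pi, Subsingleton.eq_univ_of_nonempty (singleton_nonempty _)]
    · simp [absMinor]
  | succ m ih =>
    rcases d with _ | d
    · have hZ : zonotope A = univ := Subsingleton.eq_univ_of_nonempty (zonotope_nonempty A)
      rw [hZ, Finset.sum_eq_single ∅]
      · simp [absMinor, volume_pi]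
      · intro B _ hB
        rw [absMinor, dif_neg (by simpa using hB)]
      · simp
    by_cases hA : A 0 = 0
    · rw [zonotope_succ_of_eq_zero A hA, ih, Finset.sum_finset_fin_succ]
      simp only [absMinor_map_succ, absMinor_cons_zero_of_eq_zero A hA, Finset.sum_const_zero,
        add_zero]
    · obtain ⟨L, hL⟩ := SeparatingDual.exists_continuousLinearEquiv_apply_eq (R := ℝ) hA
        (y := Pi.single (0 : Fin (d + 1)) (1 : ℝ)) (by simp)
      let f : (Fin (d + 1) → ℝ) →ₗ[ℝ] (Fin (d + 1) → ℝ) := L.toLinearEquiv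
      have hf : f.det ≠ 0 := (LinearEquiv.isUnit_det' L.toLinearEquiv).ne_zero
      have hf0 : ENNReal.ofReal |f.det| ≠ 0 := by simpa using hf
      rw [← ENNReal.mul_right_inj hf0 ENNReal.ofReal_ne_top,
        ← Measure.addHaar_image_linearMap volume f, image_zonotope, Finset.mul_sum]
      simp only [← absMinor_linearMap]
      have hfA : f (A 0) = Pi.single 0 1 := hL
      rw [volume_zonotope_succ_of_eq_single (fun i => f (A i)) hfA, ih, ih,
        Finset.sum_finset_fin_succ]
      simp only [absMinor_map_succ, absMinor_cons_zero_of_eq_single (fun i => f (A i)) hfA]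

/-- **Zonotope volume as the Tutte evaluation `M(A;1,1)`.** Let `A` be a finite family of
vectors in `ℤ^d`.  The volume of the zonotope `Z(A) = {Σ λ_i a_i : 0 ≤ λ_i ≤ 1}` equals the
sum, over all `d`-element linearly independent subfamilies `B`, of the absolute value of the
determinant of the `d × d` matrix whose columns are the vectors of `B` (in the order induced
by the index set). -/
theorem zonotope_volume {d m : ℕ} (A : Fin m → Fin d → ℤ) :
    MeasureTheory.volume
        {x : Fin d → ℝ | ∃ lam : Fin m → ℝ, (∀ i, 0 ≤ lam i ∧ lam i ≤ 1) ∧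
          x = ∑ i, lam i • (fun j => (A i j : ℝ))}
      = ∑ B : Finset (Fin m),
          if h : B.card = d ∧ LinearIndependent ℝ (fun i : B => fun j => (A (↑i) j : ℝ)) then
            (((Matrix.of fun i j : Fin d => A (↑(B.orderIsoOfFin h.1 j)) i).det.natAbs : ℕ) : ℝ≥0∞)
          else 0 := by
  refine (volume_zonotope_eq_sum_absMinor fun i j => (A i j : ℝ)).trans ?_
  refine Finset.sum_congr rfl fun B _ => ?_
  have hcast (h : B.card = d) :
      (Matrix.of fun i j : Fin d => (A (B.orderEmbOfFin h j) i : ℝ)).det =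
        ((Matrix.of fun i j : Fin d => A (B.orderEmbOfFin h j) i).det : ℝ) := by
    rw [Int.cast_det]
    rfl
  unfold absMinor
  by_cases h : B.card = d
  · by_cases hli : LinearIndependent ℝ (fun i : B => fun j => (A (↑i) j : ℝ))
    · rw [dif_pos h, dif_pos ⟨h, hli⟩, hcast, ← Int.cast_abs, Int.abs_eq_natAbs, Int.cast_natCast,
        ENNReal.ofReal_natCast]
      rfl
    · rw [dif_pos h, dif_neg fun h' => hli h'.2]
      suffices (Matrix.of fun i j : Fin d => (A (B.orderEmbOfFin h j) i : ℝ)).det = 0 by simp [this]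
      by_contra hdet
      refine hli ?_
      have := Matrix.linearIndependent_cols_of_det_ne_zero hdet
      rw [← linearIndependent_equiv (B.orderIsoOfFin h).toEquiv]
      exact this
  · rw [dif_neg h, dif_neg fun h' => h h'.1]
end
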